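/- Let V be a rational vertex operator algebra with inequivalent irreducible modules W^1, …, W^s (each W^j = ⊕_{n≥0} W^j(n) with W^j(0) ≠ 0). Then A_{n,m}(V) ≅ ⊕_{l=0}^{min(m,n)} ⊕_{i=1}^s Hom_C(W^i(m-l), W^i(n-l)) as A_n(V)-A_m(V)-bimodules. -/

import Mathlib

/-- Generalized binomial coefficient `C(n, k)` for `n : ℤ`, valued in `ℂ`. -/
noncomputable def cbinom (n : ℤ) (k : ℕ) : ℂ :=
  (∏ i ∈ Finset.range k, ((n : ℂ) - (i : ℂ))) / (Nat.factorial k : ℂ)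

/-- A vertex operator algebra structure on a complex vector space `V`. -/
structure VOA (V : Type) [AddCommGroup V] [Module ℂ V] where
  mode : V → ℤ → Module.End ℂ V
  vacuum : V
  conformal : V
  grading : ℤ → Submodule ℂ V
  internal : Function.Bijective (DirectSum.coeLinearMap grading)
  mode_add : ∀ (u v : V) (n : ℤ), mode (u + v) n = mode u n + mode v n
  mode_smul : ∀ (c : ℂ) (u : V) (n : ℤ), mode (c • u) n = c • mode u n
  truncation : ∀ u v : V, ∃ N : ℤ, ∀ n : ℤ, N ≤ n → mode u n v = 0
  vacuum_mem : vacuum ∈ grading 0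
  conformal_mem : conformal ∈ grading 2
  vacuum_mode : ∀ (v : V) (n : ℤ), mode vacuum n v = if n = -1 then v else 0
  creation : ∀ (u : V) (n : ℤ), 0 ≤ n → mode u n vacuum = 0
  creation_neg_one : ∀ u : V, mode u (-1) vacuum = u
  L0_eigen : ∀ (n : ℤ) (u : V), u ∈ grading n → mode conformal 1 u = (n : ℂ) • u
  Lneg1_deriv : ∀ (u : V) (n : ℤ), mode (mode conformal 0 u) n = (-n : ℂ) • mode u (n - 1)
  grading_mode : ∀ (r s m : ℤ) (u v : V), u ∈ grading r → v ∈ grading s →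
    mode u m v ∈ grading (r + s - m - 1)
  bounded_below : ∃ N : ℤ, ∀ n : ℤ, n < N → grading n = ⊥
  fin_dim : ∀ n : ℤ, FiniteDimensional ℂ (grading n)
  borcherds : ∀ (p q r : ℤ) (u v w : V),
    (∑ᶠ i : ℕ, cbinom p i • mode (mode u (r + i) v) (p + q - i) w) =
    ∑ᶠ i : ℕ, ((-1 : ℂ) ^ i * cbinom r i) •
      (mode u (p + r - i) (mode v (q + i) w)
        - (-1 : ℂ) ^ r • mode v (q + r - i) (mode u (p + i) w))

variable {V : Type} [AddCommGroup V] [Module ℂ V]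

/-- Projection onto the weight-`n` subspace. -/
noncomputable def VOA.proj (d : VOA V) (n : ℤ) : V →ₗ[ℂ] V :=
  (d.grading n).subtype ∘ₗ (DirectSum.component ℂ ℤ (fun m => d.grading m) n) ∘ₗ
    (LinearEquiv.ofBijective (DirectSum.coeLinearMap d.grading) d.internal).symm.toLinearMap

/-- `Res_z (1+z)^N z^{-k} Y(u,z)v` for a vector `u` regarded as having weight contribution `N`. -/
noncomputable def VOA.hres (d : VOA V) (N k : ℤ) (u v : V) : V :=
  ∑ᶠ i : ℕ, cbinom N i • d.mode u ((i : ℤ) - k) v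

/-- `Res_z (1+z)^{wt u + m} z^{-k} Y(u,z)v`, extended bilinearly from homogeneous `u`. -/
noncomputable def VOA.bres (d : VOA V) (m k : ℤ) (u v : V) : V :=
  ∑ᶠ n : ℤ, d.hres (n + m) k (d.proj n u) v

/-- The Zhu product `u * v`. -/
noncomputable def VOA.star (d : VOA V) (u v : V) : V := d.bres 0 1 u v

/-- The Zhu circle product `u ∘ v`. -/
noncomputable def VOA.circ (d : VOA V) (u v : V) : V := d.bres 0 2 u v

/-- The subspace `O(V)` spanned by all `u ∘ v`. -/
def VOA.Ozhu (d : VOA V) : Submodule ℂ V := Submodule.span ℂ {w : V | ∃ u v : V, w = d.circ u v}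

/-- The product `u ∘_n v`. -/
noncomputable def VOA.circn (d : VOA V) (n : ℕ) (u v : V) : V := d.bres n (2 * n + 2) u v

/-- The product `u *_n v` of Dong–Li–Mason. -/
noncomputable def VOA.starn (d : VOA V) (n : ℕ) (u v : V) : V :=
  ∑ m ∈ Finset.range (n + 1),
    ((-1 : ℂ) ^ m * cbinom ((m : ℤ) + (n : ℤ)) n) • d.bres n ((n : ℤ) + (m : ℤ) + 1) u v

/-- The subspace `O_n(V)`. -/
def VOA.On (d : VOA V) (n : ℕ) : Submodule ℂ V :=
  Submodule.span ℂ ({w : V | ∃ u v : V, w = d.circn n u v} ∪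
    {w : V | ∃ u : V, w = d.mode d.conformal 0 u + d.mode d.conformal 1 u})

/-- The Dong–Jiang product `u *_{m,p}^n v`. -/
noncomputable def VOA.starmpn (d : VOA V) (m p n : ℕ) (u v : V) : V :=
  ∑ i ∈ Finset.range (p + 1),
    ((-1 : ℂ) ^ i * cbinom ((m : ℤ) + (n : ℤ) - (p : ℤ) + (i : ℤ)) i) •
      d.bres m ((m : ℤ) + (n : ℤ) - (p : ℤ) + (i : ℤ) + 1) u v

/-- The Dong–Jiang product `u ∘_m^n v`. -/
noncomputable def VOA.circmn (d : VOA V) (n m : ℕ) (u v : V) : V :=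
  d.bres m ((n : ℤ) + (m : ℤ) + 2) u v

/-- The subspace `O_{n,m}(V) = O'_{n,m}(V) + O''_{n,m}(V) + O'''_{n,m}(V)` of Dong–Jiang. -/
def VOA.Onm (d : VOA V) (n m : ℕ) : Submodule ℂ V :=
  Submodule.span ℂ (
    {w : V | ∃ u v : V, w = d.circmn n m u v} ∪
    {w : V | ∃ u : V, w = d.mode d.conformal 0 u + d.mode d.conformal 1 u
        + (((m : ℂ) - (n : ℂ)) • u)} ∪
    {w : V | ∃ (u a b c : V) (p₁ p₂ p₃ : ℕ), w = d.starmpn m p₃ n u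
        (d.starmpn m p₁ p₃ (d.starmpn p₁ p₂ p₃ a b) c
          - d.starmpn m p₂ p₃ a (d.starmpn m p₁ p₂ b c))} ∪
    {w : V | ∃ (p : ℕ) (u x v : V), x ∈ d.On p ∧ w = d.starmpn m p n (d.starmpn p p n u x) v})

/-- The subspace `C_2(V)` spanned by the `u_{-2} v`. -/
def VOA.C2 (d : VOA V) : Submodule ℂ V := Submodule.span ℂ {w : V | ∃ u v : V, w = d.mode u (-2) v}

/-- `V` is a simple vertex operator algebra: its only ideals are `0` and `V`. -/
def VOA.IsSimpleVOA (d : VOA V) : Prop :=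
  (∃ v : V, v ≠ 0) ∧ ∀ P : Submodule ℂ V,
    (∀ (u : V) (n : ℤ), ∀ w ∈ P, d.mode u n w ∈ P) → P = ⊥ ∨ P = ⊤

/-- A weak module for the vertex operator algebra `d`. -/
structure WeakMod (d : VOA V) (M : Type) [AddCommGroup M] [Module ℂ M] where
  act : V → ℤ → Module.End ℂ M
  act_add : ∀ (u v : V) (n : ℤ), act (u + v) n = act u n + act v n
  act_smul : ∀ (c : ℂ) (u : V) (n : ℤ), act (c • u) n = c • act u n
  truncation : ∀ (u : V) (w : M), ∃ N : ℤ, ∀ n : ℤ, N ≤ n → act u n w = 0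
  vacuum_act : ∀ (w : M) (n : ℤ), act d.vacuum n w = if n = -1 then w else 0
  borcherds : ∀ (p q r : ℤ) (u v : V) (w : M),
    (∑ᶠ i : ℕ, cbinom p i • act (d.mode u (r + i) v) (p + q - i) w) =
    ∑ᶠ i : ℕ, ((-1 : ℂ) ^ i * cbinom r i) •
      (act u (p + r - i) (act v (q + i) w)
        - (-1 : ℂ) ^ r • act v (q + r - i) (act u (p + i) w))

/-- An admissible (ℤ₊-graded) module for the vertex operator algebra `d`. -/
structure AdmMod (d : VOA V) (M : Type) [AddCommGroup M] [Module ℂ M]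
    extends WeakMod d M where
  gr : ℤ → Submodule ℂ M
  gr_internal : Function.Bijective (DirectSum.coeLinearMap gr)
  gr_neg : ∀ n : ℤ, n < 0 → gr n = ⊥
  gr_act : ∀ (r : ℤ) (u : V), u ∈ d.grading r → ∀ (m n : ℤ) (w : M), w ∈ gr n →
    act u m w ∈ gr (r + n - m - 1)

variable {M : Type} [AddCommGroup M] [Module ℂ M]

/-- The zero-mode `o(v) = v_{wt v - 1}`, extended linearly from homogeneous `v`. -/
noncomputable def WeakMod.o {d : VOA V} (W : WeakMod d M) (v : V) (w : M) : M :=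
  ∑ᶠ r : ℤ, W.act (d.proj r v) (r - 1) w

/-- The mode `o_t(v) = v_{wt v - 1 - t}`, extended linearly from homogeneous `v`. -/
noncomputable def WeakMod.ot {d : VOA V} (W : WeakMod d M) (t : ℤ) (v : V) (w : M) : M :=
  ∑ᶠ r : ℤ, W.act (d.proj r v) (r - 1 - t) w

/-- The subspace `Ω_n(M)` of a weak module. -/
def WeakMod.OmegaSet {d : VOA V} (W : WeakMod d M) (n : ℕ) : Set M :=
  {w : M | ∀ (r : ℤ) (u : V), u ∈ d.grading r → ∀ m : ℤ, m > r - 1 + (n : ℤ) → W.act u m w = 0}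

/-- A subspace stable under all modes. -/
def WeakMod.IsStable {d : VOA V} (W : WeakMod d M) (P : Submodule ℂ M) : Prop :=
  ∀ (u : V) (n : ℤ), ∀ w ∈ P, W.act u n w ∈ P

/-- A subspace compatible with the grading of an admissible module. -/
def AdmMod.IsGraded {d : VOA V} (A : AdmMod d M) (P : Submodule ℂ M) : Prop :=
  P = ⨆ n : ℤ, (P ⊓ A.gr n)

/-- `P` is an irreducible admissible submodule. -/
def AdmMod.IrredSub {d : VOA V} (A : AdmMod d M) (P : Submodule ℂ M) : Prop :=
  P ≠ ⊥ ∧ A.toWeakMod.IsStable P ∧ A.IsGraded P ∧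
    ∀ Q : Submodule ℂ M, Q ≤ P → A.toWeakMod.IsStable Q → A.IsGraded Q → Q = ⊥ ∨ Q = P

/-- The admissible module is irreducible. -/
def AdmMod.IsIrreducible {d : VOA V} (A : AdmMod d M) : Prop :=
  (∃ w : M, w ≠ 0) ∧
    ∀ P : Submodule ℂ M, A.toWeakMod.IsStable P → A.IsGraded P → P = ⊥ ∨ P = ⊤

/-- Rationality: every admissible module is a direct sum of irreducible admissible submodules. -/
def Rational (d : VOA V) : Prop :=
  ∀ (M : Type) [AddCommGroup M] [Module ℂ M] (A : AdmMod d M),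
    ∃ (ι : Type) (f : ι → Submodule ℂ M),
      (∀ i, A.IrredSub (f i)) ∧ iSupIndep f ∧ (⨆ i, f i) = ⊤

/-- Equivalence of admissible modules. -/
def AdmEquiv {d : VOA V} {M₁ M₂ : Type} [AddCommGroup M₁] [Module ℂ M₁]
    [AddCommGroup M₂] [Module ℂ M₂] (A₁ : AdmMod d M₁) (A₂ : AdmMod d M₂) : Prop :=
  ∃ e : M₁ ≃ₗ[ℂ] M₂, ∀ (u : V) (n : ℤ) (w : M₁), e (A₁.act u n w) = A₂.act u n (e w)

/-- An ordinary-module structure on a weak module: a `ℂ`-grading by finite dimensional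
`L(0)`-eigenspaces, bounded below in each coset of `ℤ`. -/
structure OrdinaryStruct {d : VOA V} (W : WeakMod d M) where
  grc : ℂ → Submodule ℂ M
  internal : Function.Bijective (DirectSum.coeLinearMap grc)
  eigen : ∀ (lam : ℂ) (w : M), w ∈ grc lam → W.act d.conformal 1 w = lam • w
  findim : ∀ lam : ℂ, FiniteDimensional ℂ (grc lam)
  bounded : ∀ lam : ℂ, ∃ N : ℤ, ∀ n : ℤ, n < N → grc (lam + (n : ℂ)) = ⊥

/-- An admissible module is ordinary. -/
def AdmMod.IsOrdinary {d : VOA V} (A : AdmMod d M) : Prop :=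
  Nonempty (OrdinaryStruct A.toWeakMod)

/-- A realization of the quotient associative algebra `V/Osub` with product induced by `mu`. -/
structure Realization (Osub : Submodule ℂ V) (mu : V → V → V) (one : V) where
  carrier : Type
  [ring : Ring carrier]
  [alg : Algebra ℂ carrier]
  emb : V →ₗ[ℂ] carrier
  surj : Function.Surjective emb
  ker_eq : LinearMap.ker emb = Osub
  mul_compat : ∀ u v : V, emb (mu u v) = emb u * emb v
  one_compat : emb one = 1

/-- The realized algebra is semisimple. -/
def Realization.Semisimple {Osub : Submodule ℂ V} {mu : V → V → V} {one : V}
    (R : Realization Osub mu one) : Prop :=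
  letI := R.ring; IsSemisimpleRing R.carrier

/-- The realized algebra is finite dimensional over `ℂ`. -/
def Realization.FinDim {Osub : Submodule ℂ V} {mu : V → V → V} {one : V}
    (R : Realization Osub mu one) : Prop :=
  letI := R.ring; letI := R.alg; FiniteDimensional ℂ R.carrier

/-- A module over the quotient algebra `V/Osub`, given as a representation of `V`
killing `Osub` and multiplicative for `mu`. -/
structure RepOf (Osub : Submodule ℂ V) (mu : V → V → V) (one : V)
    (U : Type) [AddCommGroup U] [Module ℂ U] where
  rep : V →ₗ[ℂ] Module.End ℂ U
  kills : ∀ v ∈ Osub, rep v = 0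
  mul_compat : ∀ u v : V, rep (mu u v) = rep u * rep v
  one_compat : rep one = 1

/-- Simplicity of such a representation. -/
def RepOf.IsSimple {Osub : Submodule ℂ V} {mu : V → V → V} {one : V}
    {U : Type} [AddCommGroup U] [Module ℂ U] (Z : RepOf Osub mu one U) : Prop :=
  (∃ u : U, u ≠ 0) ∧
    ∀ P : Submodule ℂ U, (∀ v : V, ∀ x ∈ P, Z.rep v x ∈ P) → P = ⊥ ∨ P = ⊤

/-- Equivalence of two such representations. -/
def RepEquiv {Osub : Submodule ℂ V} {mu : V → V → V} {one : V}
    {U₁ U₂ : Type} [AddCommGroup U₁] [Module ℂ U₁] [AddCommGroup U₂] [Module ℂ U₂]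
    (Z₁ : RepOf Osub mu one U₁) (Z₂ : RepOf Osub mu one U₂) : Prop :=
  ∃ e : U₁ ≃ₗ[ℂ] U₂, ∀ (v : V) (x : U₁), e (Z₁.rep v x) = Z₂.rep v (e x)

section
open Finset

theorem cbinom_eq_choose (x : ℤ) (k : ℕ) : cbinom x k = ((Ring.choose x k : ℤ) : ℂ) := by
  have h : cbinom x k = Ring.choose (x : ℂ) k := by
    have h1 : (descPochhammer ℤ k).smeval (x : ℂ) = ∏ i ∈ range k, ((x : ℂ) - (i : ℂ)) := by
      induction k with
      | zero => simp
      | succ k ih =>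
        rw [descPochhammer_succ_right, Polynomial.smeval_mul, ih, prod_range_succ,
          Polynomial.smeval_sub, Polynomial.smeval_X, Polynomial.smeval_natCast]
        simp
    rw [Ring.choose_eq_smul, cbinom, h1, smul_eq_mul, div_eq_inv_mul]
  rw [h]
  exact (Ring.map_choose (Int.castRingHom ℂ) x k).symm

theorem cbinom_zero_right (x : ℤ) : cbinom x 0 = 1 := by simp [cbinom]

theorem cbinom_one_right (x : ℤ) : cbinom x 1 = x := by simp [cbinom]

theorem cbinom_succ_succ (x : ℤ) (k : ℕ) :
    cbinom (x + 1) (k + 1) = cbinom x k + cbinom x (k + 1) := by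
  simp only [cbinom_eq_choose, Ring.choose_succ_succ]; push_cast; ring

theorem cbinom_natCast (n k : ℕ) : cbinom (n : ℤ) k = (n.choose k : ℂ) := by
  rw [cbinom_eq_choose, Ring.choose_natCast]; simp

theorem cbinom_natCast_of_lt {n k : ℕ} (h : n < k) : cbinom (n : ℤ) k = 0 := by
  rw [cbinom_natCast, Nat.choose_eq_zero_of_lt h]; simp

theorem cbinom_add (x y : ℤ) (k : ℕ) :
    cbinom (x + y) k = ∑ ij ∈ antidiagonal k, cbinom x ij.1 * cbinom y ij.2 := by
  simp only [cbinom_eq_choose, Ring.add_choose_eq k (Commute.all x y)]; push_cast; rfl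

theorem cbinom_neg (x : ℤ) (k : ℕ) : cbinom (-x) k = (-1) ^ k * cbinom (x + k - 1) k := by
  simp only [cbinom_eq_choose, Ring.choose_neg]
  rw [Units.smul_def]; simp [Int.negOnePow]

theorem cbinom_succ_mul (x : ℤ) (k : ℕ) :
    ((k : ℂ) + 1) * cbinom x (k + 1) = (x - k) * cbinom x k := by
  have h1 : ((k : ℂ) + 1) ≠ 0 := by exact_mod_cast Nat.succ_ne_zero k
  have h2 : ((k.factorial : ℕ) : ℂ) ≠ 0 := by exact_mod_cast Nat.factorial_ne_zero k
  simp only [cbinom, prod_range_succ, Nat.factorial_succ]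
  push_cast
  field_simp

theorem cbinom_succ_mul' (x : ℤ) (k : ℕ) :
    ((k : ℂ) + 1) * cbinom x (k + 1) = x * cbinom (x - 1) k := by
  have h1 : ((k : ℂ) + 1) ≠ 0 := by exact_mod_cast Nat.succ_ne_zero k
  have h2 : ((k.factorial : ℕ) : ℂ) ≠ 0 := by exact_mod_cast Nat.factorial_ne_zero k
  simp only [cbinom, prod_range_succ', Nat.factorial_succ]
  push_cast
  have : ∀ i : ℕ, ((x : ℂ) - ((i : ℂ) + 1)) = (x - 1 - i) := fun i => by ring
  simp only [this]
  field_simp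
  ring

theorem cbinom_sub_one_self (s : ℕ) : cbinom ((s : ℤ) - 1) s = if s = 0 then 1 else 0 := by
  cases s with
  | zero => simp [cbinom_zero_right]
  | succ s => 
    have := cbinom_natCast_of_lt (Nat.lt_succ_self s)
    simpa using this

theorem sum_antidiagonal_antidiagonal_assoc {Z : Type*} [AddCommMonoid Z] (N : ℕ)
    (f : ℕ → ℕ → ℕ → Z) :
    ∑ p ∈ antidiagonal N, ∑ q ∈ antidiagonal p.2, f p.1 q.1 q.2 =
      ∑ p ∈ antidiagonal N, ∑ q ∈ antidiagonal p.1, f q.1 q.2 p.2 := by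
  simp only [sum_sigma']
  apply sum_nbij' (fun ⟨⟨i, _⟩, ⟨k, l⟩⟩ ↦ ⟨(i + k, l), (i, k)⟩)
    (fun ⟨⟨_, l⟩, ⟨i, k⟩⟩ ↦ ⟨(i, k + l), (k, l)⟩) <;>
  · rintro ⟨⟨i, j⟩, ⟨k, l⟩⟩ h
    simp only [mem_sigma, HasAntidiagonal.mem_antidiagonal] at h ⊢
    try (obtain ⟨rfl, rfl⟩ := h; simp [add_assoc])

section triangular
variable {Z : Type*} [AddCommGroup Z] [Module ℂ Z]

/-- The triangular transform relating residues to the truncated products `*_{m,p}^n`. -/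
noncomputable def triStar (c : ℤ) (x : ℕ → Z) (N : ℕ) : Z :=
  ∑ ij ∈ antidiagonal N, ((-1 : ℂ) ^ ij.1 * cbinom (c - ij.2) ij.1) • x ij.2

/-- The inverse of the transform `triStar`. -/
noncomputable def triInv (c : ℤ) (y : ℕ → Z) (N : ℕ) : Z :=
  ∑ ij ∈ antidiagonal N, ((-1 : ℂ) ^ ij.1 * cbinom (N - c - 1) ij.1) • y ij.2

theorem triInv_triStar (c : ℤ) (x : ℕ → Z) (N : ℕ) : triInv c (triStar c x) N = x N := by
  simp only [triInv, triStar, smul_sum, smul_smul]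
  rw [sum_antidiagonal_antidiagonal_assoc N fun i k l => ((-1 : ℂ) ^ i * cbinom (N - c - 1) i *
    ((-1) ^ k * cbinom (c - l) k)) • x l]
  have key : ∀ p ∈ HasAntidiagonal.antidiagonal N, ∑ q ∈ HasAntidiagonal.antidiagonal p.1,
      ((-1 : ℂ) ^ q.1 * cbinom (N - c - 1) q.1 * ((-1) ^ q.2 * cbinom (c - p.2) q.2)) • x p.2 =
      if p = (0, N) then x N else 0 := by
    rintro ⟨s, t⟩ h1
    rw [HasAntidiagonal.mem_antidiagonal] at h1
    have h4 : (N : ℤ) - c - 1 + (c - t) = (s : ℤ) - 1 := by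
      have : (N : ℤ) = s + t := by exact_mod_cast h1.symm
      rw [this]; ring
    have h5 : ∑ q ∈ HasAntidiagonal.antidiagonal s, ((-1 : ℂ) ^ q.1 * cbinom (N - c - 1) q.1 *
        ((-1) ^ q.2 * cbinom (c - t) q.2)) = (-1) ^ s * cbinom (s - 1) s := by
      rw [← h4, cbinom_add, mul_sum]
      refine sum_congr rfl fun q hq => ?_
      rw [HasAntidiagonal.mem_antidiagonal] at hq
      rw [← hq, pow_add]; ring
    rw [← sum_smul, h5, cbinom_sub_one_self]
    rcases eq_or_ne s 0 with rfl | hs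
    · obtain rfl : t = N := by omega
      simp
    · simp [hs]
  rw [sum_congr rfl key]
  simp

theorem triStar_triInv (c : ℤ) (x y : ℕ → Z) (B : ℕ) (h : ∀ N ≤ B, x N = triInv c y N) :
    ∀ N ≤ B, triStar c x N = y N := by
  intro N
  induction N using Nat.strong_induction_on with
  | _ N ih =>
    intro hN
    have h1 := h N hN
    rw [← triInv_triStar c x N] at h1
    unfold triInv at h1
    rw [Finset.Nat.sum_antidiagonal_eq_sum_range_succ_mk,
      Finset.Nat.sum_antidiagonal_eq_sum_range_succ_mk, sum_range_succ', sum_range_succ'] at h1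
    have h2 : ∀ i ∈ range N, ((-1 : ℂ) ^ (i + 1) * cbinom (N - c - 1) (i + 1)) •
        triStar c x (N - (i + 1)) = ((-1 : ℂ) ^ (i + 1) * cbinom (N - c - 1) (i + 1)) •
        y (N - (i + 1)) := by
      intro i hi
      rw [mem_range] at hi
      rw [ih _ (by omega) (by omega)]
    rw [sum_congr rfl h2] at h1
    simpa [cbinom_zero_right] using h1

end triangular

theorem finsum_eq_sum_range {Z : Type*} [AddCommMonoid Z] {f : ℕ → Z} {K : ℕ}
    (h : ∀ i, K ≤ i → f i = 0) : ∑ᶠ i, f i = ∑ i ∈ range K, f i := by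
  refine finsum_eq_sum_of_support_subset _ fun i hi => ?_
  by_contra hc
  simp only [coe_range, Set.mem_Iio, not_lt] at hc
  exact hi (h i hc)

section graded
variable {X Z : Type*} [AddCommGroup X] [Module ℂ X] [AddCommGroup Z] [Module ℂ Z]
  {g : ℤ → Submodule ℂ X}


theorem graded_induction (h : Function.Bijective (DirectSum.coeLinearMap g))
    {p : X → Prop} (hom : ∀ a, ∀ x ∈ g a, p x)
    (add : ∀ x y, p x → p y → p (x + y)) (x : X) : p x := by
  have h1 : DirectSum.IsInternal g := h
  have hx : x ∈ ⨆ i, g i := by rw [h1.submodule_iSup_eq_top]; trivial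
  exact Submodule.iSup_induction g (motive := p) hx hom (hom 0 0 (zero_mem _)) add

theorem graded_ext (h : Function.Bijective (DirectSum.coeLinearMap g))
    {f f' : X →ₗ[ℂ] Z} (hom : ∀ a, ∀ x ∈ g a, f x = f' x) : f = f' :=
  LinearMap.ext fun x => graded_induction h (p := fun x => f x = f' x) hom
    (fun x y hx hy => by rw [map_add, map_add, hx, hy]) x

/-- Glue linear maps given on the homogeneous components of an internally graded space. -/
noncomputable def gradedLift (h : Function.Bijective (DirectSum.coeLinearMap g))
    (F : ℤ → X →ₗ[ℂ] Z) : X →ₗ[ℂ] Z :=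
  DirectSum.toModule ℂ ℤ Z (fun i => F i ∘ₗ (g i).subtype) ∘ₗ
    (LinearEquiv.ofBijective (DirectSum.coeLinearMap g) h).symm.toLinearMap

theorem decompose_of_mem (h : Function.Bijective (DirectSum.coeLinearMap g))
    {a : ℤ} {x : X} (hx : x ∈ g a) :
    (LinearEquiv.ofBijective (DirectSum.coeLinearMap g) h).symm x =
      DirectSum.lof ℂ ℤ (fun i => g i) a ⟨x, hx⟩ := by
  rw [LinearEquiv.symm_apply_eq]
  simp

theorem gradedLift_of_mem (h : Function.Bijective (DirectSum.coeLinearMap g))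
    (F : ℤ → X →ₗ[ℂ] Z) {a : ℤ} {x : X} (hx : x ∈ g a) :
    gradedLift h F x = F a x := by
  simp [gradedLift, decompose_of_mem h hx]

/-- The projection onto a homogeneous component. -/
noncomputable def gradedProj (h : Function.Bijective (DirectSum.coeLinearMap g))
    (n : ℤ) : X →ₗ[ℂ] X :=
  (g n).subtype ∘ₗ (DirectSum.component ℂ ℤ (fun m => g m) n) ∘ₗ
    (LinearEquiv.ofBijective (DirectSum.coeLinearMap g) h).symm.toLinearMap

theorem gradedProj_mem (h : Function.Bijective (DirectSum.coeLinearMap g))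
    (n : ℤ) (x : X) : gradedProj h n x ∈ g n := by
  simp [gradedProj]

theorem gradedProj_of_mem (h : Function.Bijective (DirectSum.coeLinearMap g))
    {a : ℤ} {x : X} (hx : x ∈ g a) (n : ℤ) :
    gradedProj h n x = if n = a then x else 0 := by
  simp only [gradedProj, LinearMap.comp_apply, LinearEquiv.coe_coe, decompose_of_mem h hx]
  by_cases hn : n = a
  · subst hn; simp [DirectSum.component.lof_self]
  · rw [DirectSum.component.of, dif_neg (Ne.symm hn)]; simp [hn]

theorem gradedProj_support_finite (h : Function.Bijective (DirectSum.coeLinearMap g))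
    (x : X) : {n | gradedProj h n x ≠ 0}.Finite := by
  refine graded_induction h (p := fun x => {n | gradedProj h n x ≠ 0}.Finite) ?_ ?_ x
  · intro a x hx
    refine (Set.finite_singleton a).subset fun n hn => ?_
    rw [Set.mem_ofPred_eq, gradedProj_of_mem h hx] at hn
    simpa using (ite_ne_right_iff.mp hn).1
  · intro x y hx hy
    refine (hx.union hy).subset fun n hn => ?_
    by_contra hc
    simp only [Set.mem_union, Set.mem_ofPred_eq, not_or, not_not] at hc
    exact hn (by rw [map_add, hc.1, hc.2, add_zero])

theorem finsum_gradedProj (h : Function.Bijective (DirectSum.coeLinearMap g))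
    (F : ℤ → X →ₗ[ℂ] Z) (x : X) :
    ∑ᶠ n, F n (gradedProj h n x) = gradedLift h F x := by
  have hs : ∀ x, (Function.support fun n => F n (gradedProj h n x)).Finite := fun x =>
    (gradedProj_support_finite h x).subset fun n hn => by
      intro hc; exact hn (by simp [hc])
  refine graded_induction h (p := fun x => ∑ᶠ n, F n (gradedProj h n x) = gradedLift h F x) ?_ ?_ x
  · intro a x hx
    rw [gradedLift_of_mem h F hx, finsum_eq_single _ a, gradedProj_of_mem h hx, if_pos rfl]
    intro n hn
    rw [gradedProj_of_mem h hx, if_neg hn, map_zero]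
  · intro x y hx hy
    rw [map_add, ← hx, ← hy, ← finsum_add_distrib (hs x) (hs y)]
    simp only [map_add]

end graded

/-- The adjoint module. -/
def VOA.adjoint (d : VOA V) : WeakMod d V where
  act := d.mode
  act_add := d.mode_add
  act_smul := d.mode_smul
  truncation := d.truncation
  vacuum_act := fun w n => d.vacuum_mode w n
  borcherds := d.borcherds

namespace WeakMod
variable {d : VOA V} (W : WeakMod d M)

/-- The action of a fixed mode as a linear map in the vector. -/
def actL (n : ℤ) : V →ₗ[ℂ] Module.End ℂ M where
  toFun u := W.act u n
  map_add' u v := W.act_add u v n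
  map_smul' c u := W.act_smul c u n

@[simp] theorem actL_apply (n : ℤ) (u : V) : W.actL n u = W.act u n := rfl

open Filter in
theorem eventually_act_eq_zero (u : V) (w : M) (s : ℤ) :
    ∀ᶠ K : ℕ in atTop, ∀ i, K ≤ i → W.act u (s + i) w = 0 := by
  obtain ⟨N, hN⟩ := W.truncation u w
  filter_upwards [eventually_ge_atTop (N - s).toNat] with K hK i hi
  exact hN _ (by omega)

open Filter in
/-- The Borcherds identity with finite sums. -/
theorem eventually_borcherds (p q r : ℤ) (u v : V) (w : M) :
    ∀ᶠ K : ℕ in atTop,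
      ∑ i ∈ range K, cbinom p i • W.act (d.mode u (r + i) v) (p + q - i) w =
      ∑ i ∈ range K, ((-1 : ℂ) ^ i * cbinom r i) •
        (W.act u (p + r - i) (W.act v (q + i) w)
          - (-1 : ℂ) ^ r • W.act v (q + r - i) (W.act u (p + i) w)) := by
  filter_upwards [d.adjoint.eventually_act_eq_zero u v r, W.eventually_act_eq_zero v w q,
    W.eventually_act_eq_zero u w p] with K h1 h2 h3
  rw [← finsum_eq_sum_range, ← finsum_eq_sum_range, W.borcherds]
  · intro i hi
    rw [h2 i hi, h3 i hi]; simp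
  · intro i hi
    have : d.mode u (r + i) v = 0 := h1 i hi
    rw [this, ← actL_apply, map_zero]; simp

/-- `ot` as a bilinear map. -/
noncomputable def otL (t : ℤ) : V →ₗ[ℂ] Module.End ℂ M :=
  gradedLift d.internal fun r => W.actL (r - 1 - t)

theorem otL_of_mem (t : ℤ) {r : ℤ} {u : V} (hu : u ∈ d.grading r) :
    W.otL t u = W.act u (r - 1 - t) := gradedLift_of_mem d.internal _ hu

theorem ot_eq (t : ℤ) (u : V) (w : M) : W.ot t u w = W.otL t u w := by
  have := finsum_gradedProj d.internal (fun r => (W.actL (r - 1 - t)).flip w) u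
  refine this.trans ?_
  suffices gradedLift d.internal (fun r => (W.actL (r - 1 - t)).flip w) = (W.otL t).flip w by
    rw [this]; rfl
  refine graded_ext d.internal fun a x hx => ?_
  rw [gradedLift_of_mem _ _ hx, LinearMap.flip_apply, LinearMap.flip_apply, W.otL_of_mem t hx]; rfl

theorem o_eq (u : V) (w : M) : W.o u w = W.otL 0 u w := by
  rw [← ot_eq]; simp [WeakMod.o, WeakMod.ot]

end WeakMod

namespace VOA
variable (d : VOA V)

/-- `hres` as a bilinear map. -/
noncomputable def hresL (N k : ℤ) : V →ₗ[ℂ] V →ₗ[ℂ] V :=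
  have hs : ∀ u v,
      (Function.support fun i : ℕ => cbinom N i • d.mode u ((i : ℤ) - k) v).Finite := by
    intro u v
    obtain ⟨K, hK⟩ := (d.adjoint.eventually_act_eq_zero u v (-k)).exists
    refine (Set.finite_Iio K).subset fun i hi => ?_
    by_contra hc
    refine hi ?_
    have : d.mode u (-k + i) v = 0 := hK i (by simpa using hc)
    change cbinom N i • d.mode u ((i : ℤ) - k) v = 0
    rw [show (i : ℤ) - k = -k + i by ring, this, smul_zero]
  LinearMap.mk₂ ℂ (d.hres N k)
    (fun u u' v => by
      simp only [hres]
      rw [← finsum_add_distrib (hs _ _) (hs _ _)]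
      simp only [d.mode_add, LinearMap.add_apply, smul_add])
    (fun c u v => by
      simp only [hres]
      rw [smul_finsum' _ (hs _ _)]
      simp only [d.mode_smul, LinearMap.smul_apply, smul_comm c])
    (fun u v v' => by
      simp only [hres]
      rw [← finsum_add_distrib (hs _ _) (hs _ _)]
      simp only [map_add, smul_add])
    (fun c u v => by
      simp only [hres]
      rw [smul_finsum' _ (hs _ _)]
      simp only [map_smul, smul_comm c])

theorem hresL_apply (N k : ℤ) (u v : V) : d.hresL N k u v = d.hres N k u v := rfl

open Filter in
theorem eventually_hres (N k : ℤ) (u v : V) : ∀ᶠ K : ℕ in atTop,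
    d.hresL N k u v = ∑ i ∈ range K, cbinom N i • d.mode u ((i : ℤ) - k) v := by
  filter_upwards [d.adjoint.eventually_act_eq_zero u v (-k)] with K hK
  rw [hresL_apply, hres, finsum_eq_sum_range]
  intro i hi
  have : d.mode u (-k + i) v = 0 := hK i hi
  rw [show (i : ℤ) - k = -k + i by ring, this, smul_zero]

/-- `bres` as a bilinear map. -/
noncomputable def bresL (m k : ℤ) : V →ₗ[ℂ] V →ₗ[ℂ] V :=
  gradedLift d.internal fun a => d.hresL (a + m) k

theorem bresL_of_mem (m k : ℤ) {a : ℤ} {u : V} (hu : u ∈ d.grading a) :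
    d.bresL m k u = d.hresL (a + m) k u := gradedLift_of_mem d.internal _ hu

theorem bres_eq (m k : ℤ) (u v : V) : d.bres m k u v = d.bresL m k u v := by
  have := finsum_gradedProj d.internal (fun a => (d.hresL (a + m) k).flip v) u
  refine this.trans ?_
  suffices gradedLift d.internal (fun a => (d.hresL (a + m) k).flip v) = (d.bresL m k).flip v by
    rw [this]; rfl
  refine graded_ext d.internal fun a x hx => ?_
  rw [gradedLift_of_mem _ _ hx, LinearMap.flip_apply, LinearMap.flip_apply, d.bresL_of_mem m k hx]

/-- `starmpn` as a bilinear map. -/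
noncomputable def starL (m p n : ℕ) : V →ₗ[ℂ] V →ₗ[ℂ] V :=
  ∑ i ∈ range (p + 1), ((-1 : ℂ) ^ i * cbinom ((m : ℤ) + n - p + i) i) •
    d.bresL m ((m : ℤ) + n - p + i + 1)

theorem starmpn_eq (m p n : ℕ) (u v : V) : d.starmpn m p n u v = d.starL m p n u v := by
  simp [starmpn, starL, bres_eq, LinearMap.sum_apply]

theorem starL_of_mem (m p n : ℕ) {a : ℤ} {u : V} (hu : u ∈ d.grading a) (v : V) :
    d.starL m p n u v =
      triStar (m + n) (fun N => d.hresL (a + m) (n + m + 1 - N) u v) p := by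
  rw [triStar, Finset.Nat.sum_antidiagonal_eq_sum_range_succ_mk]
  simp only [starL, LinearMap.sum_apply, LinearMap.smul_apply, d.bresL_of_mem _ _ hu]
  refine sum_congr rfl fun i hi => ?_
  rw [mem_range] at hi
  rw [Nat.cast_sub (by omega)]
  rw [show (m : ℤ) + n - p + i = m + n - (p - i) by ring,
    show (m : ℤ) + n - (p - i) + 1 = n + m + 1 - (p - i) by ring]

/-- Residues expressed through the truncated products. -/
theorem hresL_eq_triInv (m n N : ℕ) {a : ℤ} {u : V} (hu : u ∈ d.grading a) (v : V) :
    d.hresL (a + m) (n + m + 1 - N) u v =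
      triInv (m + n) (fun p => d.starL m p n u v) N := by
  simp only [d.starL_of_mem m _ n hu]
  rw [triInv_triStar (m + n) (fun N : ℕ => d.hresL (a + m) (n + m + 1 - N) u v)]

end VOA

theorem map_triStar {Z Z' : Type*} [AddCommGroup Z] [Module ℂ Z] [AddCommGroup Z'] [Module ℂ Z']
    (f : Z →ₗ[ℂ] Z') (c : ℤ) (x : ℕ → Z) (N : ℕ) :
    f (triStar c x N) = triStar c (fun j => f (x j)) N := by
  simp [triStar]

theorem map_triInv {Z Z' : Type*} [AddCommGroup Z] [Module ℂ Z] [AddCommGroup Z'] [Module ℂ Z']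
    (f : Z →ₗ[ℂ] Z') (c : ℤ) (x : ℕ → Z) (N : ℕ) :
    f (triInv c x N) = triInv c (fun j => f (x j)) N := by
  simp [triInv]

namespace VOA
variable (d : VOA V)

theorem translate_eq (u : V) : d.mode d.conformal 0 u = d.mode u (-2) d.vacuum := by
  have h := d.creation_neg_one (d.mode d.conformal 0 u)
  rw [d.Lneg1_deriv] at h
  simpa using h.symm

theorem translate_mem {a : ℤ} {u : V} (hu : u ∈ d.grading a) :
    d.mode d.conformal 0 u ∈ d.grading (a + 1) := by
  have := d.grading_mode 2 a 0 _ _ d.conformal_mem hu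
  rwa [show 2 + a - 0 - 1 = a + 1 by ring] at this

theorem graded_induction₂ {p : V → V → Prop}
    (hom : ∀ a b, ∀ u ∈ d.grading a, ∀ v ∈ d.grading b, p u v)
    (add₁ : ∀ u u' v, p u v → p u' v → p (u + u') v)
    (add₂ : ∀ u v v', p u v → p u v' → p u (v + v')) (u v : V) : p u v := by
  refine graded_induction d.internal (p := fun u => ∀ v, p u v) ?_ ?_ u v
  · intro a u hu v
    exact graded_induction d.internal (p := fun v => p u v) (fun b v hv => hom a b u hu v hv)
      (fun v v' => add₂ u v v') v
  · intro u u' h h' v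
    exact add₁ u u' v (h v) (h' v)

end VOA

theorem WeakMod.act_translate {d : VOA V} (W : WeakMod d M) (u : V) (k : ℤ) (w : M) :
    W.act (d.mode d.conformal 0 u) k w = -(k : ℂ) • W.act u (k - 1) w := by
  obtain ⟨K, hK, hK2⟩ := ((W.eventually_borcherds k 0 (-2) u d.vacuum w).and
    (Filter.eventually_ge_atTop 2)).exists
  obtain ⟨K, rfl⟩ := Nat.exists_eq_add_of_le' hK2
  rw [sum_range_succ', sum_range_succ', sum_eq_zero, sum_eq_zero (s := range (K + 2))] at hK
  · simp only [zero_add, Nat.cast_one, Nat.cast_zero, add_zero, cbinom_one_right,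
      cbinom_zero_right, one_smul, sub_zero] at hK
    rw [show (-2 : ℤ) + 1 = -1 by norm_num, d.creation_neg_one, ← d.translate_eq] at hK
    rw [neg_smul]
    exact eq_neg_of_add_eq_zero_right hK
  · intro i _
    rw [W.vacuum_act, W.vacuum_act, if_neg (by omega), if_neg (by omega)]
    simp
  · intro i _
    rw [d.creation _ _ (by push_cast; omega), ← W.actL_apply, map_zero]
    simp

namespace AdmMod
variable {d : VOA V} (A : AdmMod d M)

theorem eq_zero_of_mem_neg {c : ℤ} {w : M} (hw : w ∈ A.gr c) (hc : c < 0) : w = 0 := by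
  rw [A.gr_neg c hc] at hw
  simpa using hw

theorem otL_mem (t : ℤ) (v : V) {c : ℤ} {w : M} (hw : w ∈ A.gr c) :
    A.otL t v w ∈ A.gr (c + t) := by
  refine graded_induction d.internal (p := fun v => A.otL t v w ∈ A.gr (c + t)) ?_ ?_ v
  · intro a v hv
    rw [A.otL_of_mem t hv]
    have := A.gr_act a v hv (a - 1 - t) c w hw
    rwa [show a + c - (a - 1 - t) - 1 = c + t by ring] at this
  · intro v v' h h'
    rw [map_add]
    exact add_mem h h'

theorem otL_hresL {a b c : ℤ} {u v : V} (hu : u ∈ d.grading a) (hv : v ∈ d.grading b) {w : M}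
    (hw : w ∈ A.gr c) (m n N : ℤ) (hc : c ≤ m) : ∀ᶠ K : ℕ in Filter.atTop,
    A.otL (n - m) (d.hresL (a + m) (n + m + 1 - N) u v) w =
      ∑ i ∈ range K, ((-1 : ℂ) ^ i * cbinom (N - m - n - 1) i) •
        A.otL (n - (N - i)) u (A.otL (N - i - m) v w) := by
  filter_upwards [d.eventually_hres (a + m) (n + m + 1 - N) u v,
    A.eventually_borcherds (a + m) (b - 1 + m - N) (N - m - n - 1) u v w] with K h1 h2
  have h3 : ∀ i : ℕ, A.otL (n - m) (d.mode u (i - (n + m + 1 - N)) v) w =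
      A.act (d.mode u (N - m - n - 1 + i) v) (a + m + (b - 1 + m - N) - i) w := by
    intro i
    rw [show (i : ℤ) - (n + m + 1 - N) = N - m - n - 1 + i by ring,
      A.otL_of_mem _ (d.grading_mode a b _ u v hu hv)]
    congr 2; ring
  rw [h1]
  simp only [map_sum, map_smul, LinearMap.sum_apply, LinearMap.smul_apply, h3]
  rw [h2]
  refine sum_congr rfl fun i _ => ?_
  have h4 : A.act u (a + m + i) w = 0 :=
    A.eq_zero_of_mem_neg (A.gr_act a u hu (a + m + i) c w hw) (by omega)
  rw [h4, map_zero, smul_zero, sub_zero, A.otL_of_mem _ hu, A.otL_of_mem _ hv]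
  rw [show a + m + (N - m - n - 1) - i = a - 1 - (n - (N - i)) by ring,
    show b - 1 + m - N + i = b - 1 - (N - i - m) by ring]

theorem otL_hresL_nat {a c : ℤ} {u : V} (hu : u ∈ d.grading a) (v : V) {w : M}
    (hw : w ∈ A.gr c) (m n : ℤ) (N : ℕ) (hc : c ≤ m) :
    A.otL (n - m) (d.hresL (a + m) (n + m + 1 - N) u v) w =
      triInv (m + n) (fun p => A.otL (n - p) u (A.otL (p - m) v w)) N := by
  refine graded_induction d.internal (p := fun v => A.otL (n - m)
    (d.hresL (a + m) (n + m + 1 - N) u v) w =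
      triInv (m + n) (fun p => A.otL (n - p) u (A.otL (p - m) v w)) N) ?_ ?_ v
  · intro b v hv
    obtain ⟨K, hK, hN⟩ := ((A.otL_hresL hu hv hw m n N hc).and
      (Filter.eventually_ge_atTop (N + 1))).exists
    rw [hK, triInv, Finset.Nat.sum_antidiagonal_eq_sum_range_succ_mk,
      ← sum_subset (range_subset_range.mpr hN)]
    · refine sum_congr rfl fun i hi => ?_
      rw [mem_range] at hi
      rw [Nat.cast_sub (by omega), show (N : ℤ) - m - n - 1 = N - (m + n) - 1 by ring]
    · intro i _ hi
      rw [mem_range, not_lt] at hi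
      rw [A.eq_zero_of_mem_neg (A.otL_mem (N - i - m) v hw) (by omega), map_zero, smul_zero]
  · intro v v' h h'
    simp only [map_add, LinearMap.add_apply, h, h', triInv, ← sum_add_distrib, smul_add]

theorem otL_starL (m p n : ℕ) (u v : V) {c : ℤ} {w : M} (hw : w ∈ A.gr c) (hc : c ≤ m) :
    A.otL (n - m) (d.starL m p n u v) w = A.otL (n - p) u (A.otL (p - m) v w) := by
  refine graded_induction d.internal (p := fun u =>
    A.otL (n - m) (d.starL m p n u v) w = A.otL (n - p) u (A.otL (p - m) v w)) ?_ ?_ u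
  · intro a u hu
    rw [d.starL_of_mem m p n hu]
    have := map_triStar ((A.otL (n - m)).flip w) (m + n)
      (fun N : ℕ => d.hresL (a + m) (n + m + 1 - N) u v) p
    rw [LinearMap.flip_apply] at this
    rw [this]
    exact triStar_triInv _ _ (fun p : ℕ => A.otL (n - p) u (A.otL (p - m) v w)) p
      (fun N _ => A.otL_hresL_nat hu v hw m n N hc) p le_rfl
  · intro u u' h h'
    simp only [map_add, LinearMap.add_apply, h, h']

theorem otL_circ (m n : ℕ) (u v : V) {c : ℤ} {w : M} (hw : w ∈ A.gr c) (hc : c ≤ m) :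
    A.otL (n - m) (d.bresL m (n + m + 2) u v) w = 0 := by
  refine d.graded_induction₂ (p := fun u v =>
    A.otL (n - m) (d.bresL m (n + m + 2) u v) w = 0) ?_ ?_ ?_ u v
  · intro a b u hu v hv
    obtain ⟨K, hK⟩ := (A.otL_hresL hu hv hw m n (-1) hc).exists
    rw [d.bresL_of_mem _ _ hu, show (n : ℤ) + m + 2 = n + m + 1 - (-1) by ring, hK]
    refine sum_eq_zero fun i _ => ?_
    rw [A.eq_zero_of_mem_neg (A.otL_mem (-1 - i - m) v hw) (by omega), map_zero, smul_zero]
  · intro u u' v h h'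
    simp only [map_add, LinearMap.add_apply, h, h', add_zero]
  · intro u v v' h h'
    simp only [map_add, LinearMap.add_apply, h, h', add_zero]

theorem otL_translate (t : ℤ) (u : V) (w : M) :
    A.otL t (d.mode d.conformal 0 u + d.mode d.conformal 1 u - (t : ℂ) • u) w = 0 := by
  refine graded_induction d.internal (p := fun u =>
    A.otL t (d.mode d.conformal 0 u + d.mode d.conformal 1 u - (t : ℂ) • u) w = 0) ?_ ?_ u
  · intro a u hu
    rw [d.L0_eigen a u hu, map_sub, map_add, A.otL_of_mem _ (d.translate_mem hu), map_smul,
      map_smul, A.otL_of_mem _ hu]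
    simp only [LinearMap.sub_apply, LinearMap.add_apply, LinearMap.smul_apply]
    rw [A.act_translate, show a + 1 - 1 - t - 1 = a - 1 - t by ring]
    push_cast
    module
  · intro u u' h h'
    simp only [map_add, map_sub, map_smul, smul_add, LinearMap.add_apply, LinearMap.sub_apply,
      LinearMap.smul_apply] at h h' ⊢
    linear_combination (norm := module) h + h'

theorem otL_On (p : ℕ) {x : V} (hx : x ∈ d.On p) {c : ℤ} {w : M} (hw : w ∈ A.gr c) (hc : c ≤ p) :
    A.otL 0 x w = 0 := by
  have h : d.On p ≤ LinearMap.ker ((A.otL 0).flip w) := by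
    refine Submodule.span_le.mpr ?_
    rintro x (⟨u, v, rfl⟩ | ⟨u, rfl⟩)
    · have := A.otL_circ p p u v hw hc
      rw [sub_self] at this
      simpa [VOA.circn, d.bres_eq, two_mul] using this
    · have := A.otL_translate 0 u w
      simpa using this
  exact h hx

theorem otL_Onm (n m : ℕ) {x : V} (hx : x ∈ d.Onm n m) {c : ℤ} {w : M} (hw : w ∈ A.gr c)
    (hc : c ≤ m) : A.otL (n - m) x w = 0 := by
  have h : d.Onm n m ≤ LinearMap.ker ((A.otL (n - m)).flip w) := by
    refine Submodule.span_le.mpr ?_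
    rintro x (((⟨u, v, rfl⟩ | ⟨u, rfl⟩) | ⟨u, a, b, c', p₁, p₂, p₃, rfl⟩) | ⟨p, u, x, v, hx, rfl⟩) <;>
      simp only [SetLike.mem_coe, LinearMap.mem_ker, LinearMap.flip_apply, d.starmpn_eq]
    · have := A.otL_circ m n u v hw hc
      simpa [VOA.circmn, d.bres_eq] using this
    · have := A.otL_translate (n - m) u w
      rw [← this]
      congr 2
      push_cast
      module
    · rw [A.otL_starL _ _ _ _ _ hw hc]
      have h1 := A.otL_mem (p₁ - m) c' hw
      rw [map_sub, LinearMap.sub_apply, A.otL_starL _ _ _ _ _ hw hc, A.otL_starL _ _ _ _ _ hw hc,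
        A.otL_starL _ _ _ _ _ hw hc, A.otL_starL _ _ _ _ _ h1 (by omega), sub_self, map_zero]
    · have h1 := A.otL_mem (p - m) v hw
      rw [A.otL_starL _ _ _ _ _ hw hc, A.otL_starL _ _ _ _ _ h1 (by omega), sub_self,
        A.otL_On p hx h1 (by omega), map_zero]
  exact h hx

end AdmMod

/-- The inverse triangular transform of a delta sequence. -/
theorem triInv_delta {Z : Type*} [AddCommGroup Z] [Module ℂ Z] (c q : ℕ) (z : Z) (N : ℕ) :
    triInv (c + q) (fun p => if p = q then z else 0) N =
      (if N ≤ c + q then cbinom c (c + q - N) else 0) • z := by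
  rw [triInv]
  by_cases hq : q ≤ N
  · rw [sum_eq_single (N - q, q)]
    · rw [if_pos rfl]
      congr 1
      have h1 : (N : ℤ) - (c + q) - 1 = -(c + q + 1 - N) := by ring
      rw [h1, cbinom_neg, ← mul_assoc, ← pow_add, Even.neg_one_pow ⟨_, rfl⟩, one_mul,
        show (c : ℤ) + q + 1 - N + ((N - q : ℕ) : ℤ) - 1 = c by omega, cbinom_natCast]
      split_ifs with h
      · rw [cbinom_natCast]
        congr 1
        exact Nat.choose_symm_of_eq_add (by omega)
      · rw [Nat.choose_eq_zero_of_lt (by omega)]; simp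
    · rintro ⟨i, j⟩ h1 h2
      rw [HasAntidiagonal.mem_antidiagonal] at h1
      rw [if_neg, smul_zero]
      rintro rfl
      exact h2 (by ext <;> simp; omega)
    · intro h
      exact absurd (HasAntidiagonal.mem_antidiagonal.mpr (by simp; omega)) h
  · rw [sum_eq_zero]
    · rw [if_pos (by omega), cbinom_natCast_of_lt (by omega), zero_smul]
    · rintro ⟨i, j⟩ h1
      rw [HasAntidiagonal.mem_antidiagonal] at h1
      rw [if_neg (by simp; omega), smul_zero]

namespace VOA
variable (d : VOA V)

theorem hresL_vacuum (c q N : ℕ) (v : V) :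
    d.hresL c (q + c + 1 - N) d.vacuum v =
      (if N ≤ c + q then cbinom c (c + q - N) else 0) • v := by
  rw [hresL_apply, hres]
  by_cases h : N ≤ c + q
  · rw [if_pos h, finsum_eq_single _ (c + q - N)]
    · rw [d.vacuum_mode, if_pos (by push_cast [Nat.cast_sub h]; ring)]
    · intro i hi
      rw [d.vacuum_mode, if_neg (by omega), smul_zero]
  · rw [if_neg h, zero_smul]
    rw [← finsum_zero]
    congr 1
    ext i
    rw [d.vacuum_mode, if_neg (by omega), smul_zero]

theorem starL_vacuum (m p q : ℕ) (v : V) :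
    d.starL m p q d.vacuum v = if p = q then v else 0 := by
  rw [d.starL_of_mem m p q d.vacuum_mem]
  refine triStar_triInv _ _ (fun p => if p = q then v else 0) p (fun N _ => ?_) p le_rfl
  rw [triInv_delta, zero_add, hresL_vacuum]

/-- Skew symmetry. -/
theorem skew (r : ℤ) (u v : V) : ∀ᶠ K : ℕ in Filter.atTop,
    d.mode u r v = ∑ i ∈ range K, ((-1 : ℂ) ^ (r + i + 1)) •
      d.mode (d.mode v (r + i) u) (-1 - i) d.vacuum := by
  filter_upwards [d.adjoint.eventually_borcherds (-1) 0 r v u d.vacuum,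
    Filter.eventually_ge_atTop 1] with K h hK
  obtain ⟨K, rfl⟩ := Nat.exists_eq_add_of_le' hK
  rw [sum_range_succ' (n := K) (f := fun i : ℕ => ((-1 : ℂ) ^ i * cbinom r i) • _)] at h
  simp only [adjoint] at h
  rw [sum_eq_zero (s := range K) (f := fun i : ℕ => ((-1 : ℂ) ^ (i + 1) * cbinom r (i + 1)) • _)]
    at h
  · have h3 : (-1 : ℂ) ^ r ≠ 0 := zpow_ne_zero _ (by norm_num)
    have h2 : ∀ i : ℕ, cbinom (-1) i = (-1) ^ i := by
      intro i
      rw [cbinom_neg, show (1 : ℤ) + i - 1 = i by ring, cbinom_natCast]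
      simp
    simp only [h2, Nat.cast_zero, add_zero, sub_zero, zero_add, d.creation _ 0 le_rfl, map_zero,
      zero_sub, d.creation_neg_one, cbinom_zero_right, pow_zero, mul_one, one_smul] at h
    have h4 : d.mode u r v = (-(-1 : ℂ) ^ r) • -((-1 : ℂ) ^ r • d.mode u r v) := by
      rw [smul_neg, neg_smul, neg_neg, ← mul_smul, ← mul_zpow]
      simp
    rw [h4, ← h, smul_sum]
    refine sum_congr rfl fun i _ => ?_
    rw [← mul_smul]
    congr 1
    rw [zpow_add₀ (by norm_num), zpow_add₀ (by norm_num)]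
    simp
  · intro i _
    rw [d.creation _ _ (by positivity), d.creation _ _ (by push_cast; omega)]
    simp

theorem hresL_translate (N k : ℤ) (u v : V) :
    d.hresL (N + 1) k (d.mode d.conformal 0 u) v =
      ((k : ℂ) - N - 1) • d.hresL N k u v + (k : ℂ) • d.hresL N (k + 1) u v := by
  obtain ⟨K, h1, h2, h3⟩ := (((Filter.tendsto_add_atTop_nat 1).eventually
    (d.eventually_hres (N + 1) k (d.mode d.conformal 0 u) v)).and
    ((d.eventually_hres N k u v).and
      ((Filter.tendsto_add_atTop_nat 1).eventually (d.eventually_hres N (k + 1) u v)))).exists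
  rw [h1, h2, h3, sum_range_succ', sum_range_succ' (n := K), smul_add, ← add_assoc, smul_sum,
    smul_sum, ← sum_add_distrib]
  congr 1
  · refine sum_congr rfl fun i _ => ?_
    rw [d.Lneg1_deriv, show ((i + 1 : ℕ) : ℤ) - k - 1 = i - k by push_cast; ring,
      show ((i + 1 : ℕ) : ℤ) - (k + 1) = i - k by push_cast; ring, cbinom_succ_succ,
      LinearMap.smul_apply, ← mul_smul, ← mul_smul, ← mul_smul, ← add_smul]
    congr 1
    have := cbinom_succ_mul N i
    push_cast
    linear_combination -this
  · rw [d.Lneg1_deriv]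
    simp [cbinom_zero_right]
    rw [show -k - 1 = -1 + -k by ring]

/-- A linear map that intertwines translation sees a descendant of the vacuum as a multiple. -/
theorem map_mode_vacuum {Z : Type*} [AddCommGroup Z] [Module ℂ Z] (τ : V →ₗ[ℂ] Z) (c : ℤ)
    (hτ : ∀ (b : ℤ), ∀ y ∈ d.grading b, τ (d.mode d.conformal 0 y) = ((c : ℂ) - b) • τ y)
    (i : ℕ) {b : ℤ} {y : V} (hy : y ∈ d.grading b) :
    τ (d.mode y (-1 - i) d.vacuum) = cbinom (c - b) i • τ y := by
  induction i generalizing b y with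
  | zero => simp [d.creation_neg_one, cbinom_zero_right]
  | succ i ih =>
    have h1 := ih (d.translate_mem hy)
    rw [d.Lneg1_deriv, hτ b y hy, LinearMap.smul_apply, map_smul] at h1
    have h2 : ((i : ℂ) + 1) ≠ 0 := by exact_mod_cast Nat.succ_ne_zero i
    have h3 := cbinom_succ_mul' (c - b) i
    rw [show c - (b + 1) = c - b - 1 by ring] at h1
    rw [show (-1 : ℤ) - (i + 1 : ℕ) = -1 - i - 1 by push_cast; ring]
    rw [← smul_right_inj h2, ← mul_smul, h3]
    push_cast at h1 ⊢
    rw [mul_comm, mul_smul, ← h1]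
    congr 1; ring

theorem map_hresL_vacuum {Z : Type*} [AddCommGroup Z] [Module ℂ Z] (τ : V →ₗ[ℂ] Z) (c : ℤ)
    (hτ : ∀ (b : ℤ), ∀ y ∈ d.grading b, τ (d.mode d.conformal 0 y) = ((c : ℂ) - b) • τ y)
    (N k : ℤ) {b : ℤ} {y : V} (hy : y ∈ d.grading b) :
    τ (d.hresL N k y d.vacuum) =
      (if 1 ≤ k then cbinom (N + (c - b)) (k - 1).toNat else 0) • τ y := by
  rw [hresL_apply, hres]
  rw [finsum_eq_sum_range (K := k.toNat), map_sum]
  · by_cases hk : 1 ≤ k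
    · obtain ⟨j, rfl⟩ : ∃ j : ℕ, k = j + 1 := ⟨(k - 1).toNat, by omega⟩
      rw [if_pos hk, show ((j : ℤ) + 1 - 1).toNat = j by omega, cbinom_add, sum_smul,
        show ((j : ℤ) + 1).toNat = j + 1 by omega, Finset.Nat.sum_antidiagonal_eq_sum_range_succ_mk]
      refine sum_congr rfl fun i hi => ?_
      rw [mem_range] at hi
      rw [map_smul, mul_smul, ← d.map_mode_vacuum τ c hτ (j - i) hy]
      congr 4
      rw [Nat.cast_sub (by omega)]; ring
    · rw [if_neg hk, show k.toNat = 0 by omega]; simp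
  · intro i hi
    rw [d.creation _ _ (by omega), smul_zero]

/-- The truncated product with `L(-1) u + L(0) u` is a multiple of the circle product. -/
theorem starL_translate (p q : ℕ) (u v : V) :
    d.starL p q q (d.mode d.conformal 0 u + d.mode d.conformal 1 u) v =
      ((-1 : ℂ) ^ q * ((q + 1) * (p + q + 1).choose (q + 1))) • d.bresL p (q + p + 2) u v := by
  refine graded_induction d.internal (p := fun u =>
    d.starL p q q (d.mode d.conformal 0 u + d.mode d.conformal 1 u) v =
      ((-1 : ℂ) ^ q * ((q + 1) * (p + q + 1).choose (q + 1))) • d.bresL p (q + p + 2) u v) ?_ ?_ u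
  · intro a u hu
    have key : ∀ k : ℤ, d.bresL p k (d.mode d.conformal 0 u + d.mode d.conformal 1 u) v =
        ((k : ℂ) - p - 1) • d.bresL p k u v + (k : ℂ) • d.bresL p (k + 1) u v := by
      intro k
      rw [map_add, LinearMap.add_apply, d.bresL_of_mem _ _ (d.translate_mem hu), d.L0_eigen a u hu,
        map_smul, LinearMap.smul_apply, d.bresL_of_mem _ _ hu, d.bresL_of_mem _ _ hu,
        show a + 1 + (p : ℤ) = a + p + 1 by ring, hresL_translate]
      push_cast
      module
    simp only [starL, LinearMap.sum_apply, LinearMap.smul_apply, key]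
    have h2 := sum_range_sub (fun i : ℕ => ((-1 : ℂ) ^ (i + 1) * (i * (p + i).choose i)) •
      d.bresL p (p + i + 1) u v) (q + 1)
    simp only [Nat.cast_zero, zero_mul, mul_zero, zero_smul, sub_zero] at h2
    rw [show (q : ℤ) + p + 2 = p + (q + 1 : ℕ) + 1 by push_cast; ring]
    have h3 : (-1 : ℂ) ^ (q + 1 + 1) = (-1) ^ q := by ring
    rw [h3] at h2
    refine Eq.trans (sum_congr rfl fun i _ => ?_) (h2.trans (by push_cast; rfl))
    rw [show (p : ℤ) + q - q + i = (p + i : ℕ) by push_cast; ring, cbinom_natCast]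
    have h4 : ((i + 1 : ℕ) : ℂ) * (p + (i + 1)).choose (i + 1) =
        (p + i + 1) * (p + i).choose i := by
      have := Nat.add_one_mul_choose_eq (p + i) i
      have h5 := congrArg (Nat.cast : ℕ → ℂ) this
      rw [← add_assoc p i 1]
      push_cast at h5 ⊢
      linear_combination -h5
    rw [h4, show ((p + i : ℕ) : ℤ) + 1 = p + i + 1 by push_cast; ring,
      show (p : ℤ) + (i + 1 : ℕ) + 1 = p + i + 1 + 1 by push_cast; ring]
    push_cast
    module
  · intro u u' h h'
    simp only [map_add, LinearMap.add_apply, smul_add] at h h' ⊢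
    rw [← h, ← h']
    abel

end VOA

/-- A system of spaces indexed by nonnegative levels on which the truncated products of `V` act. -/
structure LevelSystem (d : VOA V) where
  X : ℕ → Type
  [grp : ∀ p, AddCommGroup (X p)]
  [mod : ∀ p, Module ℂ (X p)]
  T : ∀ p q, V →ₗ[ℂ] X p →ₗ[ℂ] X q
  vac_self : ∀ p w, T p p d.vacuum w = w
  vac_ne : ∀ p q, p ≠ q → ∀ w, T p q d.vacuum w = 0
  comp : ∀ p q s u v w, T q s u (T p q v w) = T p s (d.starL p q s u v) w
  kill : ∀ p, ∀ x ∈ d.On p, ∀ w, T p p x w = 0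

attribute [instance] LevelSystem.grp LevelSystem.mod

/-- The sum `∑ ε ^ i * C(P, i) • h (r + i)` over natural numbers `i`. -/
noncomputable def binomSum {Z : Type*} [AddCommGroup Z] [Module ℂ Z] (ε : ℂ) (P : ℤ) (h : ℤ → Z)
    (r : ℤ) : Z :=
  ∑ᶠ i : ℕ, (ε ^ i * cbinom P i) • h (r + i)

section binomSum
variable {Z : Type*} [AddCommGroup Z] [Module ℂ Z]

theorem binomSum_eq_sum (ε : ℂ) (P : ℤ) {h : ℤ → Z} {r : ℤ} {K : ℕ}
    (hK : ∀ i : ℕ, K ≤ i → h (r + i) = 0) :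
    binomSum ε P h r = ∑ i ∈ range K, (ε ^ i * cbinom P i) • h (r + i) :=
  finsum_eq_sum_range fun i hi => by rw [hK i hi, smul_zero]

theorem binomSum_add_one (ε : ℂ) (P : ℤ) {h : ℤ → Z} (r : ℤ) {B : ℤ} (hB : ∀ j, B ≤ j → h j = 0) :
    binomSum ε (P + 1) h r = binomSum ε P h r + ε • binomSum ε P h (r + 1) := by
  have h1 : ∀ i : ℕ, (B - r).toNat ≤ i → h (r + 1 + i) = 0 := fun i hi => hB _ (by omega)
  have h2 : ∀ i : ℕ, (B - r).toNat + 1 ≤ i → h (r + i) = 0 := fun i hi => hB _ (by omega)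
  rw [binomSum_eq_sum ε _ h2, binomSum_eq_sum ε _ h2, binomSum_eq_sum ε _ h1, sum_range_succ',
    sum_range_succ' (n := (B - r).toNat), smul_sum, add_right_comm, ← sum_add_distrib]
  congr 1
  · refine sum_congr rfl fun i _ => ?_
    rw [cbinom_succ_succ, show r + ((i + 1 : ℕ) : ℤ) = r + 1 + i by push_cast; ring, ← mul_smul,
      ← add_smul]
    congr 1
    ring

end binomSum

/-- A two-variable sequence satisfying Pascal's recursion vanishes if it does so on a row and on
the upper half of a column. -/
theorem eq_zero_of_pascal {Z : Type*} [AddCommGroup Z] (D : ℤ → ℤ → Z)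
    (hrec : ∀ N N', D N N' = D N (N' - 1) - D (N - 1) N')
    (hrow : ∀ N, D N (-1) = 0) (hcol : ∀ N' : ℕ, D (-1) N' = 0) (N N' : ℤ) : D N N' = 0 := by
  have up : ∀ k : ℕ, ∀ N, D N (k - 1) = 0 := by
    intro k
    induction k with
    | zero => simpa using hrow
    | succ k ih =>
      have h1 : ∀ N, D N k = - D (N - 1) k := by
        intro N
        rw [hrec, ih, zero_sub]
      intro N
      rw [Nat.cast_add, Nat.cast_one, add_sub_cancel_right]
      induction N using Int.inductionOn' (b := -1) with
      | zero => exact hcol k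
      | succ N _ ih => rw [h1, add_sub_cancel_right, ih, neg_zero]
      | pred N _ ih => rw [← neg_eq_zero, ← h1, ih]
  have down : ∀ k : ℕ, ∀ N, D N (-1 - k) = 0 := by
    intro k
    induction k with
    | zero => simpa using hrow
    | succ k ih =>
      intro N
      have := hrec N (-1 - k)
      rw [ih, ih, sub_zero] at this
      rw [this]
      congr 1
      push_cast; ring
  rcases le_total (-1) N' with h | h
  · obtain ⟨k, rfl⟩ : ∃ k : ℕ, N' = k - 1 := ⟨(N' + 1).toNat, by omega⟩
    exact up k N
  · obtain ⟨k, rfl⟩ : ∃ k : ℕ, N' = -1 - k := ⟨(-1 - N').toNat, by omega⟩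
    exact down k N

namespace LevelSystem
variable {d : VOA V} (S : LevelSystem d)

theorem T_circ (p s : ℕ) (u v : V) (w : S.X p) : S.T p s (d.bresL p (s + p + 2) u v) w = 0 := by
  have h := S.comp p s s (d.mode d.conformal 0 u + d.mode d.conformal 1 u) v w
  rw [S.kill s _ (Submodule.subset_span (Or.inr ⟨u, rfl⟩)), d.starL_translate, map_smul,
    LinearMap.smul_apply] at h
  refine (smul_eq_zero.mp h.symm).resolve_left ?_
  have h1 : (((s + 1) * (p + s + 1).choose (s + 1) : ℕ) : ℂ) ≠ 0 :=
    Nat.cast_ne_zero.mpr (Nat.mul_ne_zero (by omega) (Nat.choose_pos (by omega)).ne')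
  push_cast at h1
  exact mul_ne_zero (pow_ne_zero _ (by norm_num)) h1

theorem T_hresL (p s N : ℕ) {a : ℤ} {u : V} (hu : u ∈ d.grading a) (v : V) (w : S.X p) :
    S.T p s (d.hresL (a + p) (s + p + 1 - N) u v) w =
      triInv (p + s) (fun q => S.T q s u (S.T p q v w)) N := by
  rw [d.hresL_eq_triInv p s N hu v]
  refine (map_triInv ((S.T p s).flip w) _ _ _).trans ?_
  simp only [S.comp, LinearMap.flip_apply]

theorem T_translate (p s : ℕ) {b : ℤ} {y : V} (hy : y ∈ d.grading b) :
    S.T p s (d.mode d.conformal 0 y) = ((((s - p : ℤ)) : ℂ) - b) • S.T p s y := by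
  ext w
  by_cases h0 : p + s = 0
  · obtain rfl : p = 0 := by omega
    obtain rfl : s = 0 := by omega
    have := S.kill 0 _ (Submodule.subset_span (Or.inr ⟨y, rfl⟩)) w
    rw [d.L0_eigen b y hy, map_add, LinearMap.add_apply, map_smul] at this
    simp at this ⊢
    exact eq_neg_of_add_eq_zero_left this
  · have h := S.T_hresL p s (p + s - 1) hy d.vacuum w
    have h1 : (fun q => S.T q s y (S.T p q d.vacuum w)) =
        fun q => if q = p then S.T p s y w else 0 := by
      ext q
      split_ifs with hq
      · subst hq
        rw [S.vac_self]
      · rw [S.vac_ne p q (Ne.symm hq), map_zero]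
    rw [h1, add_comm (p : ℤ), triInv_delta, if_pos (by omega),
      show s + p - (p + s - 1) = 1 by omega, cbinom_one_right,
      show (s : ℤ) + p + 1 - (p + s - 1 : ℕ) = 2 by omega, VOA.hresL_apply, VOA.hres,
      finsum_eq_sum_range (K := 2)] at h
    · rw [sum_range_succ, sum_range_one, cbinom_zero_right, cbinom_one_right] at h
      simp only [Nat.cast_zero, Nat.cast_one, zero_sub, one_smul, map_add, map_smul,
        LinearMap.add_apply, LinearMap.smul_apply, show (1 : ℤ) - 2 = -1 by ring,
        d.creation_neg_one, ← d.translate_eq] at h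
      rw [LinearMap.smul_apply]
      push_cast at h ⊢
      linear_combination (norm := module) h
    · intro i hi
      rw [d.creation _ _ (by omega), smul_zero]

theorem T_hresL_eq_zero (p s j : ℕ) {a : ℤ} {u : V} (hu : u ∈ d.grading a) (v : V) (w : S.X p) :
    S.T p s (d.hresL (a + p) (s + p + 2 + j) u v) w = 0 := by
  induction j generalizing a u with
  | zero => simpa [d.bresL_of_mem _ _ hu] using S.T_circ p s u v w
  | succ j ih =>
    have h := ih (d.translate_mem hu)
    rw [show a + 1 + (p : ℤ) = a + p + 1 by ring, d.hresL_translate, map_add, map_smul, map_smul,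
      LinearMap.add_apply, LinearMap.smul_apply, LinearMap.smul_apply, ih hu, smul_zero,
      zero_add] at h
    have h1 : (((s : ℤ) + p + 2 + j : ℤ) : ℂ) ≠ 0 := by
      exact_mod_cast (show (s : ℤ) + p + 2 + j ≠ 0 by omega)
    rw [Nat.cast_succ, ← add_assoc]
    exact (smul_eq_zero.mp h).resolve_left h1

/-- The two-step operator through level `j`, zero for negative levels. -/
noncomputable def two (p s : ℕ) (u v : V) (x : S.X p) (j : ℤ) : S.X s :=
  if 0 ≤ j then S.T j.toNat s u (S.T p j.toNat v x) else 0

theorem two_natCast (p s : ℕ) (u v : V) (x : S.X p) (j : ℕ) :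
    S.two p s u v x j = S.T j s u (S.T p j v x) := by
  rw [two, if_pos (by omega)]; rfl

theorem two_of_neg (p s : ℕ) (u v : V) (x : S.X p) {j : ℤ} (hj : j < 0) :
    S.two p s u v x j = 0 := if_neg (by omega)

theorem T_hresL_eq_binomSum (p s : ℕ) (N : ℤ) {a : ℤ} {u : V} (hu : u ∈ d.grading a) (v : V)
    (w : S.X p) :
    S.T p s (d.hresL (a + p) (s + p + 1 - N) u v) w =
      binomSum (-1) (N - p - s - 1) (fun j => S.two p s u v w (-j)) (-N) := by
  rcases lt_or_ge N 0 with hN | hN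
  · obtain ⟨j, rfl⟩ : ∃ j : ℕ, N = -1 - j := ⟨(-1 - N).toNat, by omega⟩
    rw [show (s : ℤ) + p + 1 - (-1 - j) = s + p + 2 + j by ring, S.T_hresL_eq_zero p s j hu,
      binomSum_eq_sum (K := 0)]
    · simp
    · intro i _
      exact S.two_of_neg _ _ _ _ _ (by omega)
  · obtain ⟨N, rfl⟩ := Int.eq_ofNat_of_zero_le hN
    rw [S.T_hresL p s N hu, binomSum_eq_sum (K := N + 1), triInv,
      Finset.Nat.sum_antidiagonal_eq_sum_range_succ_mk]
    · refine sum_congr rfl fun i hi => ?_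
      rw [mem_range] at hi
      rw [show -(-(N : ℤ) + i) = (N - i : ℕ) by omega, two_natCast, ← sub_sub]
    · intro i hi
      exact S.two_of_neg _ _ _ _ _ (by omega)

theorem map_hresL_eq_binomSum {Z : Type*} [AddCommGroup Z] [Module ℂ Z] (f : V →ₗ[ℂ] Z)
    (N k : ℤ) (u v : V) :
    f (d.hresL N k u v) = binomSum 1 N (fun j => f (d.mode u j v)) (-k) := by
  obtain ⟨K, h1, h2⟩ := ((d.eventually_hres N k u v).and
    (d.adjoint.eventually_act_eq_zero u v (-k))).exists
  rw [h1, binomSum_eq_sum (K := K), map_sum]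
  · simp [sub_eq_neg_add]
  · intro i hi
    have : d.mode u (-k + i) v = 0 := h2 i hi
    rw [this, map_zero]


theorem two_eventually_zero (p s : ℕ) (u v : V) (x : S.X p) (j : ℤ) (hj : 1 ≤ j) :
    S.two p s u v x (-j) = 0 := S.two_of_neg _ _ _ _ _ (by omega)

/-- The first column of the commutator identity, obtained from skew symmetry. -/
theorem jacobi_column (p s : ℕ) (N' : ℤ) {a b : ℤ} {u v : V} (hu : u ∈ d.grading a)
    (hv : v ∈ d.grading b) (x : S.X p) :
    binomSum 1 (a - 1 + p - N') (fun j => S.T p s (d.mode u j v) x) (N' - 1 - p - s) =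
      -((-1 : ℂ) ^ (N' - 1 - p - s) •
        S.T p s (d.hresL (b + p) (s + p + 1 - N') v u) x) := by
  set r : ℤ := N' - 1 - p - s with hr
  obtain ⟨K, hK⟩ := (d.adjoint.eventually_act_eq_zero v u r).exists
  have hK' : ∀ i : ℕ, K ≤ i → d.mode v (r + i) u = 0 := hK
  have hskew : ∀ i : ℕ, S.T p s (d.mode u (r + i) v) x = ∑ k ∈ range (K - i),
      ((-1 : ℂ) ^ (r + i + k + 1) * cbinom (N' - 2 * p - a - b + (i + k)) k) •
        S.T p s (d.mode v (r + (i + k : ℕ)) u) x := by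
    intro i
    obtain ⟨L, hL, hLK⟩ := ((d.skew (r + i) u v).and (Filter.eventually_ge_atTop (K - i))).exists
    rw [hL, map_sum, LinearMap.sum_apply]
    symm
    refine sum_subset_zero_on_sdiff (range_subset_range.mpr hLK) ?_ ?_
    · intro k hk
      simp only [mem_sdiff, mem_range] at hk
      rw [show r + i + (k : ℤ) = r + (i + k : ℕ) by push_cast; ring, hK' (i + k) (by omega)]
      have : d.mode 0 (-1 - k) = 0 := by simpa using d.mode_smul 0 0 (-1 - k)
      simp [this]
    · intro k _
      have h1 := d.grading_mode b a (r + (i + k : ℕ)) v u hv hu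
      have h2 := d.map_mode_vacuum ((S.T p s).flip x) (s - p) (fun b y hy => by
        have := S.T_translate p s hy
        simp [this]) k h1
      simp only [LinearMap.flip_apply] at h2
      rw [map_smul, LinearMap.smul_apply, show r + i + (k : ℤ) = r + (i + k : ℕ) by push_cast; ring,
        h2, ← mul_smul]
      congr 3
      rw [hr]; push_cast; ring
  have h0 : ∀ i : ℕ, K ≤ i → S.T p s (d.mode u (r + i) v) x = 0 := by
    intro i hi
    rw [hskew, Nat.sub_eq_zero_of_le hi, sum_range_zero]
  have h0' : ∀ i : ℕ, K ≤ i → (fun j => (S.T p s).flip x (d.mode v j u)) (r + i) = 0 := by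
    intro i hi
    simp [hK' i hi]
  rw [binomSum_eq_sum _ _ h0]
  have hh := map_hresL_eq_binomSum (d := d) ((S.T p s).flip x) (b + p) (s + p + 1 - N') v u
  rw [show -((s : ℤ) + p + 1 - N') = r by rw [hr]; ring, binomSum_eq_sum _ _ h0',
    LinearMap.flip_apply] at hh
  rw [hh]
  simp only [hskew, smul_sum, LinearMap.flip_apply, one_pow, one_mul, ← sum_neg_distrib]
  have h3 : ∀ F : ℕ → ℕ → S.X s, ∑ i ∈ range K, ∑ k ∈ range (K - i), F i k =
      ∑ n ∈ range K, ∑ ik ∈ antidiagonal n, F ik.1 ik.2 := by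
    intro F
    rw [sum_sigma', sum_sigma']
    refine sum_bij' (fun x _ => ⟨x.1 + x.2, (x.1, x.2)⟩) (fun x _ => ⟨x.2.1, x.2.2⟩) ?_ ?_ ?_ ?_ ?_
    · rintro ⟨i, k⟩ h
      simp at h ⊢; omega
    · rintro ⟨n, i, k⟩ h
      simp at h ⊢; omega
    · rintro ⟨i, k⟩ h
      simp
    · rintro ⟨n, i, k⟩ h
      simp at h ⊢
      exact h.2
    · rintro ⟨i, k⟩ h
      simp
  rw [h3]
  refine sum_congr rfl fun n _ => ?_
  have h4 : ∀ ik ∈ antidiagonal n, cbinom (a - 1 + p - N') ik.1 •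
      ((-1 : ℂ) ^ (r + ik.1 + ik.2 + 1) * cbinom (N' - 2 * p - a - b + (ik.1 + ik.2)) ik.2) •
        S.T p s (d.mode v (r + (ik.1 + ik.2 : ℕ)) u) x =
      (cbinom (a - 1 + p - N') ik.1 * cbinom (N' - 2 * p - a - b + n) ik.2) •
        (-1 : ℂ) ^ (r + n + 1) • S.T p s (d.mode v (r + n) u) x := by
    rintro ⟨i, k⟩ h
    rw [HasAntidiagonal.mem_antidiagonal] at h
    subst h
    push_cast
    rw [← mul_smul, ← mul_smul, add_assoc r]
    congr 1
    ring
  rw [sum_congr rfl h4, ← sum_smul, ← cbinom_add,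
    show a - 1 + p - N' + (N' - 2 * p - a - b + n) = -(b + p - n + 1) by ring, cbinom_neg,
    show b + p - n + 1 + n - 1 = b + p by ring, ← mul_smul, ← mul_smul, ← neg_smul]
  congr 1
  rw [zpow_add₀ (by norm_num), zpow_add₀ (by norm_num), zpow_natCast]
  have : ((-1 : ℂ) ^ n) * (-1) ^ n = 1 := by rw [← pow_add, Even.neg_one_pow ⟨_, rfl⟩]
  linear_combination (-(cbinom (b + p) n) * (-1 : ℂ) ^ r) * this

/-- The commutator identity for the operators of a level system. -/
theorem jacobi (p s : ℕ) (N N' : ℤ) {a b : ℤ} {u v : V} (hu : u ∈ d.grading a)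
    (hv : v ∈ d.grading b) (x : S.X p) :
    binomSum 1 (a - 1 + p - N') (fun j => S.T p s (d.mode u j v) x) (N + N' - p - s) =
      binomSum (-1) (N + N' - p - s) (fun j => S.two p s u v x (-j)) (-N) -
        (-1 : ℂ) ^ (N + N' - p - s) •
          binomSum (-1) (N + N' - p - s) (fun j => S.two p s v u x (-j)) (-N') := by
  obtain ⟨B, hB⟩ := d.truncation u v
  have hB' : ∀ j, B ≤ j → S.T p s (d.mode u j v) x = 0 := fun j hj => by simp [hB j hj]
  refine eq_of_sub_eq_zero ?_
  refine eq_zero_of_pascal (fun N N' => binomSum 1 (a - 1 + p - N')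
    (fun j => S.T p s (d.mode u j v) x) (N + N' - p - s) -
    (binomSum (-1) (N + N' - p - s) (fun j => S.two p s u v x (-j)) (-N) -
        (-1 : ℂ) ^ (N + N' - p - s) •
          binomSum (-1) (N + N' - p - s) (fun j => S.two p s v u x (-j)) (-N'))) ?_ ?_ ?_ N N'
  · intro N N'
    obtain ⟨r, hr⟩ : ∃ r, r = N + N' - p - s - 1 := ⟨_, rfl⟩
    have h1 := binomSum_add_one 1 (a - 1 + p - N') r hB'
    have h2 := binomSum_add_one (-1) r (-N) (S.two_eventually_zero p s u v x)
    have h3 := binomSum_add_one (-1) r (-N') (S.two_eventually_zero p s v u x)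
    rw [show a - 1 + p - (N' - 1) = a - 1 + p - N' + 1 by ring,
      show N + (N' - 1) - p - s = r by rw [hr]; ring, show N - 1 + N' - p - s = r by rw [hr]; ring,
      show N + N' - p - s = r + 1 by rw [hr]; ring, show -(N - 1) = -N + 1 by ring,
      show -(N' - 1) = -N' + 1 by ring, h1, h2, h3, zpow_add₀ (by norm_num), zpow_one]
    module
  · intro N
    have h1 := S.T_hresL_eq_binomSum p s N hu v x
    have h2 := map_hresL_eq_binomSum (d := d) ((S.T p s).flip x) (a + p) (s + p + 1 - N) u v
    simp only [LinearMap.flip_apply] at h2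
    rw [show a - 1 + p - (-1) = a + p by ring, show N + -1 - p - s = -(s + p + 1 - N) by ring, ← h2,
      h1, binomSum_eq_sum (h := fun j => S.two p s v u x (-j)) (K := 0)]
    · simp only [range_zero, sum_empty, smul_zero, sub_zero]
      rw [show -((s : ℤ) + p + 1 - N) = N - p - s - 1 by ring, sub_self]
    · intro i _
      exact S.two_of_neg _ _ _ _ _ (by omega)
  · intro N'
    have h1 := S.T_hresL_eq_binomSum p s N' hv u x
    have h2 := S.jacobi_column p s N' hu hv x
    rw [show -1 + (N' : ℤ) - p - s = N' - 1 - p - s by ring, h2, h1,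
      binomSum_eq_sum (h := fun j => S.two p s u v x (-j)) (K := 0)]
    · rw [show (N' : ℤ) - 1 - p - s = N' - p - s - 1 by ring]
      simp
    · intro i _
      exact S.two_of_neg _ _ _ _ _ (by omega)

end LevelSystem

theorem iSupIndep_of_separating {X Z : Type*} [AddCommGroup X] [Module ℂ X] [AddCommGroup Z]
    [Module ℂ Z] {g : ℤ → Submodule ℂ X}
    (h : ∀ n, ∃ f : X →ₗ[ℂ] Z, (∀ x ∈ g n, f x = 0 → x = 0) ∧ ∀ j, j ≠ n → ∀ x ∈ g j, f x = 0) :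
    iSupIndep g := by
  intro n
  obtain ⟨f, h1, h2⟩ := h n
  rw [Submodule.disjoint_def]
  intro x hx hx'
  refine h1 x hx ?_
  have : (⨆ j, ⨆ (_ : j ≠ n), g j) ≤ LinearMap.ker f :=
    iSup_le fun j => iSup_le fun hj x hx => h2 j hj x hx
  exact this hx'

namespace LevelSystem
variable {d : VOA V} (S : LevelSystem d)

/-- The direct sum of all levels. -/
abbrev Total : Type := DirectSum ℕ S.X

/-- The inclusion of a level. -/
noncomputable abbrev of (p : ℕ) : S.X p →ₗ[ℂ] S.Total := DirectSum.lof ℂ ℕ S.X p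

/-- The operator from level `p` to level `t`, zero if `t` is negative. -/
noncomputable def out (p : ℕ) (t : ℤ) : V →ₗ[ℂ] S.X p →ₗ[ℂ] S.Total :=
  if 0 ≤ t then (S.T p t.toNat).compr₂ (S.of t.toNat) else 0

theorem out_natCast (p t : ℕ) (u : V) (x : S.X p) : S.out p t u x = S.of t (S.T p t u x) := by
  rw [out, if_pos (by omega)]; rfl

theorem out_of_neg (p : ℕ) {t : ℤ} (ht : t < 0) (u : V) (x : S.X p) : S.out p t u x = 0 := by
  rw [out, if_neg (by omega)]; rfl

/-- The modes acting on the direct sum of all levels. -/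
noncomputable def actHom (k : ℤ) : V →ₗ[ℂ] S.Total →ₗ[ℂ] S.Total :=
  gradedLift d.internal fun a => LinearMap.flip
    (DirectSum.toModule ℂ ℕ (V →ₗ[ℂ] S.Total) fun p => (S.out p (p + a - 1 - k)).flip)

theorem actHom_of (k : ℤ) {a : ℤ} {u : V} (hu : u ∈ d.grading a) (p : ℕ) (x : S.X p) :
    S.actHom k u (S.of p x) = S.out p (p + a - 1 - k) u x := by
  rw [actHom, gradedLift_of_mem d.internal _ hu]
  simp [of]

theorem total_induction {P : S.Total → Prop} (hom : ∀ p x, P (S.of p x))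
    (add : ∀ x y, P x → P y → P (x + y)) (x : S.Total) : P x := by
  induction x using DirectSum.induction_on with
  | zero => simpa using hom 0 0
  | of p x => exact hom p x
  | add x y hx hy => exact add x y hx hy

theorem actHom_truncation (u : V) (w : S.Total) : ∃ N : ℤ, ∀ n : ℤ, N ≤ n → S.actHom n u w = 0 := by
  refine graded_induction d.internal
    (p := fun u => ∀ w, ∃ N : ℤ, ∀ n : ℤ, N ≤ n → S.actHom n u w = 0) ?_ ?_ u w
  · intro a u hu
    refine S.total_induction ?_ ?_
    · intro p x
      refine ⟨p + a, fun n hn => ?_⟩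
      rw [S.actHom_of n hu, S.out_of_neg _ (by omega)]
    · rintro x y ⟨N, h⟩ ⟨N', h'⟩
      refine ⟨max N N', fun n hn => ?_⟩
      rw [map_add, h _ (le_trans (le_max_left _ _) hn), h' _ (le_trans (le_max_right _ _) hn),
        add_zero]
  · intro u u' h h' w
    obtain ⟨N, h⟩ := h w
    obtain ⟨N', h'⟩ := h' w
    refine ⟨max N N', fun n hn => ?_⟩
    rw [map_add, LinearMap.add_apply, h _ (le_trans (le_max_left _ _) hn),
      h' _ (le_trans (le_max_right _ _) hn), add_zero]

theorem actHom_eventually (u : V) (w : S.Total) (s : ℤ) :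
    ∀ᶠ K : ℕ in Filter.atTop, ∀ i, K ≤ i → S.actHom (s + i) u w = 0 := by
  obtain ⟨N, hN⟩ := S.actHom_truncation u w
  filter_upwards [Filter.eventually_ge_atTop (N - s).toNat] with K hK i hi
  exact hN _ (by omega)

theorem actHom_actHom (p s : ℕ) {a b : ℤ} {u v : V} (hu : u ∈ d.grading a) (hv : v ∈ d.grading b)
    (x : S.X p) (k l : ℤ) (h : p + b - 1 - l + a - 1 - k = s) :
    S.actHom k u (S.actHom l v (S.of p x)) = S.of s (S.two p s u v x (p + b - 1 - l)) := by
  rw [S.actHom_of l hv]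
  rcases lt_or_ge (p + b - 1 - l) 0 with hj | hj
  · rw [S.out_of_neg _ hj, S.two_of_neg _ _ _ _ _ hj, map_zero, map_zero]
  · obtain ⟨j, hj⟩ := Int.eq_ofNat_of_zero_le hj
    rw [hj] at h ⊢
    rw [S.out_natCast, S.actHom_of k hu, h, S.out_natCast, S.two_natCast]

theorem actHom_actHom_of_neg (p : ℕ) {a b : ℤ} {u v : V} (hu : u ∈ d.grading a)
    (hv : v ∈ d.grading b) (x : S.X p) (k l : ℤ) (h : p + b - 1 - l + a - 1 - k < 0) :
    S.actHom k u (S.actHom l v (S.of p x)) = 0 := by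
  rw [S.actHom_of l hv]
  rcases lt_or_ge (p + b - 1 - l) 0 with hj | hj
  · rw [S.out_of_neg _ hj, map_zero]
  · obtain ⟨j, hj⟩ := Int.eq_ofNat_of_zero_le hj
    rw [hj] at h ⊢
    rw [S.out_natCast, S.actHom_of k hu, S.out_of_neg _ h]

theorem actHom_borcherds_of (P Q r : ℤ) {a b : ℤ} {u v : V} (hu : u ∈ d.grading a)
    (hv : v ∈ d.grading b) (p : ℕ) (x : S.X p) : ∀ᶠ K : ℕ in Filter.atTop,
    ∑ i ∈ range K, cbinom P i • S.actHom (P + Q - i) (d.mode u (r + i) v) (S.of p x) =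
      ∑ i ∈ range K, ((-1 : ℂ) ^ i * cbinom r i) •
        (S.actHom (P + r - i) u (S.actHom (Q + i) v (S.of p x))
          - (-1 : ℂ) ^ r • S.actHom (Q + r - i) v (S.actHom (P + i) u (S.of p x))) := by
  rcases lt_or_ge (p + a + b - r - 2 - P - Q) 0 with ht | ht
  · refine Filter.Eventually.of_forall fun K => ?_
    rw [sum_eq_zero, sum_eq_zero]
    · intro i _
      rw [S.actHom_actHom_of_neg p hu hv x _ _ (by omega),
        S.actHom_actHom_of_neg p hv hu x _ _ (by omega)]
      simp
    · intro i _
      rw [S.actHom_of _ (d.grading_mode a b (r + i) u v hu hv), S.out_of_neg _ (by omega),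
        smul_zero]
  · obtain ⟨s, hs⟩ := Int.eq_ofNat_of_zero_le ht
    have hj := S.jacobi p s (p + b - 1 - Q) (p + a - 1 - P) hu hv x
    rw [show a - 1 + p - (p + a - 1 - P) = P by ring,
      show (p + b - 1 - Q) + (p + a - 1 - P) - p - s = r by omega] at hj
    filter_upwards [d.adjoint.eventually_act_eq_zero u v r,
      Filter.eventually_ge_atTop (p + b - 1 - Q + 1).toNat,
      Filter.eventually_ge_atTop (p + a - 1 - P + 1).toNat] with K h1 h2 h3
    have h1' : ∀ i, K ≤ i → d.mode u (r + i) v = 0 := h1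
    rw [binomSum_eq_sum (K := K), binomSum_eq_sum (K := K), binomSum_eq_sum (K := K)] at hj
    · have e1 : ∀ i : ℕ, S.actHom (P + Q - i) (d.mode u (r + i) v) (S.of p x) =
          S.of s (S.T p s (d.mode u (r + i) v) x) := by
        intro i
        rw [S.actHom_of _ (d.grading_mode a b (r + i) u v hu hv), ← S.out_natCast]
        congr 3
        omega
      have e2 : ∀ i : ℕ, S.actHom (P + r - i) u (S.actHom (Q + i) v (S.of p x)) =
          S.of s (S.two p s u v x (-(-(p + b - 1 - Q) + i))) := by
        intro i
        rw [S.actHom_actHom p s hu hv x _ _ (by omega)]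
        congr 2
        ring
      have e3 : ∀ i : ℕ, S.actHom (Q + r - i) v (S.actHom (P + i) u (S.of p x)) =
          S.of s (S.two p s v u x (-(-(p + a - 1 - P) + i))) := by
        intro i
        rw [S.actHom_actHom p s hv hu x _ _ (by omega)]
        congr 2
        ring
      simp only [e1, e2, e3, ← map_smul, ← map_sub, ← map_sum]
      congr 1
      simp only [one_pow, one_mul] at hj
      simp only [map_smul]
      rw [hj, smul_sum, ← sum_sub_distrib]
      refine sum_congr rfl fun i _ => ?_
      module
    · intro i hi
      exact S.two_of_neg _ _ _ _ _ (by omega)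
    · intro i hi
      exact S.two_of_neg _ _ _ _ _ (by omega)
    · intro i hi
      rw [h1' i hi]; simp

theorem actHom_borcherds (P Q r : ℤ) (u v : V) (w : S.Total) : ∀ᶠ K : ℕ in Filter.atTop,
    ∑ i ∈ range K, cbinom P i • S.actHom (P + Q - i) (d.mode u (r + i) v) w =
      ∑ i ∈ range K, ((-1 : ℂ) ^ i * cbinom r i) •
        (S.actHom (P + r - i) u (S.actHom (Q + i) v w)
          - (-1 : ℂ) ^ r • S.actHom (Q + r - i) v (S.actHom (P + i) u w)) := by
  refine d.graded_induction₂ (p := fun u v => ∀ w, ∀ᶠ K : ℕ in Filter.atTop,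
    ∑ i ∈ range K, cbinom P i • S.actHom (P + Q - i) (d.mode u (r + i) v) w =
      ∑ i ∈ range K, ((-1 : ℂ) ^ i * cbinom r i) •
        (S.actHom (P + r - i) u (S.actHom (Q + i) v w)
          - (-1 : ℂ) ^ r • S.actHom (Q + r - i) v (S.actHom (P + i) u w))) ?_ ?_ ?_ u v w
  · intro a b u hu v hv
    refine S.total_induction (fun p x => S.actHom_borcherds_of P Q r hu hv p x) ?_
    intro x y hx hy
    filter_upwards [hx, hy] with K h h'
    simp only [map_add, smul_add, sum_add_distrib, h, h']
    rw [← sum_add_distrib]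
    refine sum_congr rfl fun i _ => ?_
    module
  · intro u u' v h h' w
    filter_upwards [h w, h' w] with K h h'
    simp only [map_add, LinearMap.add_apply, d.mode_add, smul_add, sum_add_distrib, h, h']
    rw [← sum_add_distrib]
    refine sum_congr rfl fun i _ => ?_
    module
  · intro u v v' h h' w
    filter_upwards [h w, h' w] with K h h'
    simp only [map_add, LinearMap.add_apply, smul_add, sum_add_distrib, h, h']
    rw [← sum_add_distrib]
    refine sum_congr rfl fun i _ => ?_
    module

/-- The grading of the direct sum by levels. -/
noncomputable def gr (n : ℤ) : Submodule ℂ S.Total :=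
  if 0 ≤ n then LinearMap.range (S.of n.toNat) else ⊥

theorem of_mem_gr (p : ℕ) (x : S.X p) : S.of p x ∈ S.gr p := by
  rw [gr, if_pos (by omega)]
  exact ⟨x, rfl⟩

theorem exists_of_mem_gr {n : ℤ} {w : S.Total} (hw : w ∈ S.gr n) :
    w = 0 ∨ ∃ p : ℕ, n = p ∧ ∃ x, w = S.of p x := by
  rw [gr] at hw
  split_ifs at hw with h
  · obtain ⟨p, rfl⟩ := Int.eq_ofNat_of_zero_le h
    obtain ⟨x, rfl⟩ := hw
    exact Or.inr ⟨p, rfl, x, rfl⟩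
  · exact Or.inl hw

theorem out_mem_gr (p : ℕ) (t : ℤ) (u : V) (x : S.X p) : S.out p t u x ∈ S.gr t := by
  rcases lt_or_ge t 0 with ht | ht
  · rw [S.out_of_neg _ ht]
    exact zero_mem _
  · obtain ⟨t, rfl⟩ := Int.eq_ofNat_of_zero_le ht
    rw [S.out_natCast]
    exact S.of_mem_gr _ _

theorem gr_internal : Function.Bijective (DirectSum.coeLinearMap S.gr) := by
  refine (DirectSum.isInternal_submodule_iff_iSupIndep_and_iSup_eq_top _).mpr ⟨?_, ?_⟩
  · refine iSupIndep_of_separating (Z := S.Total) fun n => ?_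
    rcases lt_or_ge n 0 with hn | hn
    · refine ⟨0, fun w hw _ => ?_, fun _ _ _ _ => rfl⟩
      obtain h | ⟨p, rfl, -⟩ := S.exists_of_mem_gr hw
      · exact h
      · omega
    · refine ⟨S.of n.toNat ∘ₗ DirectSum.component ℂ ℕ S.X n.toNat, fun w hw h => ?_,
        fun j hj w hw => ?_⟩
      · obtain rfl | ⟨p, rfl, x, rfl⟩ := S.exists_of_mem_gr hw
        · rfl
        · simpa [DirectSum.component.lof_self] using h
      · obtain rfl | ⟨p, rfl, x, rfl⟩ := S.exists_of_mem_gr hw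
        · simp
        · rw [LinearMap.comp_apply, DirectSum.component.of, dif_neg (by omega), map_zero]
  · refine eq_top_iff.mpr fun w _ => ?_
    refine S.total_induction (P := fun w => w ∈ ⨆ i, S.gr i) ?_ (fun x y => add_mem) w
    intro p x
    exact Submodule.mem_iSup_of_mem (p : ℤ) (S.of_mem_gr p x)

/-- The admissible module attached to a level system. -/
noncomputable def toAdmMod : AdmMod d S.Total where
  act u k := S.actHom k u
  act_add u v n := map_add _ _ _
  act_smul c u n := map_smul _ _ _
  truncation := S.actHom_truncation
  vacuum_act w n := by
    refine S.total_induction (P := fun w => S.actHom n d.vacuum w = if n = -1 then w else 0)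
      ?_ ?_ w
    · intro p x
      rw [S.actHom_of n d.vacuum_mem]
      rcases lt_or_ge (p + 0 - 1 - n) 0 with ht | ht
      · rw [S.out_of_neg _ ht, if_neg (by omega)]
      · obtain ⟨t, ht⟩ := Int.eq_ofNat_of_zero_le ht
        rw [ht, S.out_natCast]
        split_ifs with h
        · obtain rfl : t = p := by omega
          rw [S.vac_self]
        · rw [S.vac_ne _ _ (by omega), map_zero]
    · intro x y hx hy
      rw [map_add, hx, hy]
      split_ifs <;> simp
  borcherds P Q r u v w := by
    obtain ⟨K, h1, h2, h3, h4⟩ := ((S.actHom_borcherds P Q r u v w).and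
      ((d.adjoint.eventually_act_eq_zero u v r).and ((S.actHom_eventually v w Q).and
        (S.actHom_eventually u w P)))).exists
    have h2' : ∀ i : ℕ, K ≤ i → d.mode u (r + i) v = 0 := h2
    rw [finsum_eq_sum_range (K := K), finsum_eq_sum_range (K := K), h1]
    · intro i hi
      rw [h3 i hi, h4 i hi]; simp
    · intro i hi
      rw [h2' i hi]; simp
  gr := S.gr
  gr_internal := S.gr_internal
  gr_neg n hn := if_neg (by omega)
  gr_act a u hu k n w hw := by
    obtain rfl | ⟨p, rfl, x, rfl⟩ := S.exists_of_mem_gr hw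
    · rw [map_zero]
      exact zero_mem _
    · rw [S.actHom_of k hu, add_comm a]
      convert S.out_mem_gr p (p + a - 1 - k) u x using 2
      ring

theorem toAdmMod_otL (p q : ℕ) (u : V) (x : S.X p) :
    S.toAdmMod.otL (q - p) u (S.of p x) = S.of q (S.T p q u x) := by
  refine graded_induction d.internal (p := fun u =>
    S.toAdmMod.otL (q - p) u (S.of p x) = S.of q (S.T p q u x)) ?_ ?_ u
  · intro a u hu
    rw [WeakMod.otL_of_mem _ _ hu]
    refine (S.actHom_of _ hu p x).trans ?_
    rw [← S.out_natCast]
    congr 3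
    ring
  · intro u u' h h'
    rw [map_add, map_add, LinearMap.add_apply, h, h']
    simp

end LevelSystem

namespace VOA
variable (d : VOA V)

theorem starL_assoc_sub_mem (m p₁ p₂ p₃ n : ℕ) (y a b c : V) :
    d.starL m p₃ n y (d.starL m p₁ p₃ (d.starL p₁ p₂ p₃ a b) c) -
      d.starL m p₃ n y (d.starL m p₂ p₃ a (d.starL m p₁ p₂ b c)) ∈ d.Onm n m := by
  rw [← map_sub]
  refine Submodule.subset_span (Or.inl (Or.inr ⟨y, a, b, c, p₁, p₂, p₃, ?_⟩))
  simp only [starmpn_eq]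

theorem starL_assoc_sub_mem' (m p₁ p₂ n : ℕ) (a b c : V) :
    d.starL m p₁ n (d.starL p₁ p₂ n a b) c - d.starL m p₂ n a (d.starL m p₁ p₂ b c) ∈
      d.Onm n m := by
  simpa [starL_vacuum] using d.starL_assoc_sub_mem m p₁ p₂ n n d.vacuum a b c

/-- The vectors of level `q` annihilated, modulo `O_{n,m}(V)`, by all truncated products. -/
def levelKer (m q : ℕ) : Submodule ℂ V where
  carrier := {v | ∀ n y, d.starL m q n y v ∈ d.Onm n m}
  add_mem' h h' n y := by rw [map_add]; exact add_mem (h n y) (h' n y)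
  zero_mem' n y := by rw [map_zero]; exact zero_mem _
  smul_mem' c v h n y := by rw [map_smul]; exact Submodule.smul_mem _ _ (h n y)

theorem starL_mem_levelKer (m p q : ℕ) (u : V) {v : V} (hv : v ∈ d.levelKer m p) :
    d.starL m p q u v ∈ d.levelKer m q := by
  intro n y
  have := d.starL_assoc_sub_mem' m p q n y u v
  rw [← Submodule.neg_mem_iff, neg_sub] at this
  exact (Submodule.sub_mem_iff_left _ (hv n _)).mp this

theorem levelKer_le (m n : ℕ) : d.levelKer m n ≤ d.Onm n m := by
  intro v hv
  simpa [starL_vacuum] using hv n d.vacuum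

/-- The level system generated by the vacuum placed at level `m`. -/
noncomputable def vacuumLevels (m : ℕ) : LevelSystem d where
  X q := V ⧸ d.levelKer m q
  T p q :=
    { toFun := fun u => (d.levelKer m p).mapQ (d.levelKer m q) (d.starL m p q u)
        fun _ hv => d.starL_mem_levelKer m p q u hv
      map_add' := fun u u' => by
        ext v
        simp
      map_smul' := fun c u => by
        ext v
        simp }
  vac_self p w := by
    obtain ⟨w, rfl⟩ := Submodule.mkQ_surjective _ w
    simp [starL_vacuum]
  vac_ne p q h w := by
    obtain ⟨w, rfl⟩ := Submodule.mkQ_surjective _ w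
    simp [starL_vacuum, h]
  comp p q s u v w := by
    obtain ⟨w, rfl⟩ := Submodule.mkQ_surjective _ w
    simp only [LinearMap.coe_mk, AddHom.coe_mk, Submodule.mkQ_apply, Submodule.mapQ_apply]
    refine ((Submodule.Quotient.eq _).mpr fun n y => ?_).symm
    rw [map_sub]
    exact d.starL_assoc_sub_mem m p q s n y u v w
  kill p x hx w := by
    obtain ⟨w, rfl⟩ := Submodule.mkQ_surjective _ w
    simp only [LinearMap.coe_mk, AddHom.coe_mk, Submodule.mkQ_apply, Submodule.mapQ_apply]
    refine (Submodule.Quotient.mk_eq_zero _).mpr fun n y => ?_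
    have := d.starL_assoc_sub_mem' m p p n y x w
    rw [← Submodule.neg_mem_iff, neg_sub] at this
    refine (Submodule.sub_mem_iff_left _ ?_).mp this
    refine Submodule.subset_span (Or.inr ⟨p, y, x, w, hx, ?_⟩)
    simp only [starmpn_eq]

theorem starL_vacuum_right_sub_mem (m n : ℕ) (v : V) :
    d.starL m m n v d.vacuum - v ∈ d.Onm n m := by
  refine graded_induction d.internal
    (p := fun v => d.starL m m n v d.vacuum - v ∈ d.Onm n m) ?_ ?_ v
  · intro b y hy
    have hτ : ∀ (b : ℤ), ∀ y ∈ d.grading b, (d.Onm n m).mkQ (d.mode d.conformal 0 y) =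
        ((((n : ℤ) - m : ℤ) : ℂ) - b) • (d.Onm n m).mkQ y := by
      intro b y hy
      rw [← map_smul]
      refine (Submodule.Quotient.eq _).mpr ?_
      have h : d.mode d.conformal 0 y + d.mode d.conformal 1 y + (((m : ℂ) - n) • y) ∈ d.Onm n m :=
        Submodule.subset_span (Or.inl (Or.inl (Or.inr ⟨y, rfl⟩)))
      rw [d.L0_eigen b y hy] at h
      convert h using 1
      push_cast
      module
    refine (Submodule.Quotient.eq _).mp ?_
    change (d.Onm n m).mkQ _ = (d.Onm n m).mkQ y
    rw [d.starL_of_mem m m n hy, map_triStar]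
    refine (triStar_triInv _ _ (fun p => if p = m then (d.Onm n m).mkQ y else 0) m
      (fun N hN => ?_) m le_rfl).trans (if_pos rfl)
    rw [add_comm (m : ℤ), triInv_delta, d.map_hresL_vacuum _ (n - m) hτ _ _ hy, if_pos (by omega),
      if_pos (by omega)]
    congr 2
    · ring
    · omega
  · intro u v hu hv
    rw [map_add, LinearMap.add_apply, add_sub_add_comm]
    exact add_mem hu hv

/-- The vacuum at level `m` is a cyclic vector whose annihilators are the spaces `O_{n,m}(V)`. -/
theorem exists_cyclic_adm (m : ℕ) : ∃ (M : Type) (_ : AddCommGroup M) (_ : Module ℂ M)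
    (A : AdmMod d M) (x : M), x ∈ A.gr m ∧
      ∀ (n : ℕ) (v : V), A.otL (n - m) v x = 0 → v ∈ d.Onm n m := by
  let S := d.vacuumLevels m
  refine ⟨S.Total, inferInstance, inferInstance, S.toAdmMod,
    S.of m ((d.levelKer m m).mkQ d.vacuum), S.of_mem_gr m _, fun n v hv => ?_⟩
  replace hv := (S.toAdmMod_otL m n v ((d.levelKer m m).mkQ d.vacuum)).symm.trans hv
  have h1 : S.T m n v ((d.levelKer m m).mkQ d.vacuum) = 0 :=
    DirectSum.of_injective (β := S.X) n (hv.trans (map_zero _).symm)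
  have h2 : d.starL m m n v d.vacuum ∈ d.levelKer m n := (Submodule.Quotient.mk_eq_zero _).mp h1
  exact (Submodule.sub_mem_iff_right _ (d.levelKer_le m n h2)).mp
    (d.starL_vacuum_right_sub_mem m n v)

end VOA

namespace AdmMod
variable {d : VOA V} (A : AdmMod d M)

theorem gradedProj_otL (c t : ℤ) (v : V) (z : M) :
    gradedProj A.gr_internal (c + t) (A.otL t v z) = A.otL t v (gradedProj A.gr_internal c z) := by
  refine graded_induction A.gr_internal (p := fun z =>
    gradedProj A.gr_internal (c + t) (A.otL t v z) =
      A.otL t v (gradedProj A.gr_internal c z)) ?_ ?_ z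
  · intro b z hz
    rw [gradedProj_of_mem _ hz, gradedProj_of_mem _ (A.otL_mem t v hz)]
    by_cases h : c = b
    · simp [h]
    · simp [h]
  · intro x y hx hy
    simp only [map_add, hx, hy]

theorem otL_vacuum (w : M) : A.otL 0 d.vacuum w = w := by
  rw [A.otL_of_mem 0 d.vacuum_mem, A.vacuum_act, if_pos (by ring)]

/-- A nonzero homogeneous vector generates an irreducible module by single modes. -/
theorem exists_otL_eq (hA : A.IsIrreducible) {c : ℕ} {w : M} (hw : w ∈ A.gr c) (hw0 : w ≠ 0)
    (n : ℕ) {z : M} (hz : z ∈ A.gr n) : ∃ v, A.otL (n - c) v w = z := by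
  set R : ℕ → Submodule ℂ M := fun n => LinearMap.range ((A.otL (n - c)).flip w) with hR
  have hRgr : ∀ n, R n ≤ A.gr n := by
    rintro n _ ⟨v, rfl⟩
    have := A.otL_mem (n - c) v hw
    rwa [add_sub_cancel] at this
  have hP : (⨆ n, R n) = ⊤ := by
    refine (hA.2 _ ?_ ?_).resolve_left ?_
    · intro u k x hx
      refine graded_induction d.internal (p := fun u => A.act u k x ∈ ⨆ n, R n) ?_ ?_ u
      · intro a u hu
        refine Submodule.iSup_induction R (motive := fun x => A.act u k x ∈ ⨆ n, R n) hx ?_ ?_ ?_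
        · rintro n _ ⟨v, rfl⟩
          rcases lt_or_ge (n + (a - 1 - k)) 0 with hn | hn
          · have h1 := A.gr_act a u hu k n _ (hRgr n ⟨v, rfl⟩)
            rw [A.eq_zero_of_mem_neg h1 (by omega)]
            exact zero_mem _
          · obtain ⟨q, hq⟩ := Int.eq_ofNat_of_zero_le hn
            refine Submodule.mem_iSup_of_mem q ⟨d.starL c n q u v, ?_⟩
            rw [LinearMap.flip_apply, LinearMap.flip_apply, A.otL_starL c n q u v hw le_rfl,
              A.otL_of_mem (q - n) hu]
            congr 2
            omega
        · rw [map_zero]; exact zero_mem _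
        · intro x y hx hy
          rw [map_add]; exact add_mem hx hy
      · intro u u' h h'
        rw [A.act_add]; exact add_mem h h'
    · refine le_antisymm (iSup_le fun n => ?_) (iSup_le fun n => inf_le_left)
      exact le_iSup_of_le (n : ℤ) (le_inf (le_iSup R n) (hRgr n))
    · intro h
      have : w ∈ (⊥ : Submodule ℂ M) :=
        h ▸ Submodule.mem_iSup_of_mem c ⟨d.vacuum, by simp [A.otL_vacuum]⟩
      exact hw0 this
  have key : ∀ x ∈ ⨆ n, R n, gradedProj A.gr_internal n x ∈ R n := by
    intro x hx
    refine Submodule.iSup_induction R (motive := fun x => gradedProj A.gr_internal n x ∈ R n) hx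
      ?_ ?_ ?_
    · intro j x hx
      rw [gradedProj_of_mem _ (hRgr j hx)]
      split_ifs with h
      · rw [Nat.cast_inj.mp h]; exact hx
      · exact zero_mem _
    · rw [map_zero]; exact zero_mem _
    · intro x y hx hy
      rw [map_add]; exact add_mem hx hy
  have h1 := key z (hP ▸ trivial)
  rw [gradedProj_of_mem _ hz, if_pos rfl] at h1
  exact h1

variable {M₂ : Type} [AddCommGroup M₂] [Module ℂ M₂] (B : AdmMod d M₂)

theorem map_otL (e : M →ₗ[ℂ] M₂) (he : ∀ u n w, e (A.act u n w) = B.act u n (e w)) (t : ℤ) (v : V)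
    (w : M) : e (A.otL t v w) = B.otL t v (e w) := by
  refine graded_induction d.internal (p := fun v => e (A.otL t v w) = B.otL t v (e w)) ?_ ?_ v
  · intro a v hv
    rw [A.otL_of_mem t hv, B.otL_of_mem t hv, he]
  · intro x y hx hy
    simp only [map_add, LinearMap.add_apply, hx, hy]

/-- Isomorphisms of irreducible modules starting in degree zero preserve degrees. -/
theorem equiv_mem_gr (hA : A.IsIrreducible) (hB : B.IsIrreducible) (hA0 : A.gr 0 ≠ ⊥)
    (hB0 : B.gr 0 ≠ ⊥) (e : M →ₗ[ℂ] M₂) (he : ∀ u n w, e (A.act u n w) = B.act u n (e w))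
    (n : ℕ) {w : M} (hw : w ∈ A.gr n) : e w ∈ B.gr n := by
  obtain ⟨w₀, hw₀, hne⟩ := (Submodule.ne_bot_iff _).mp hA0
  obtain ⟨z₀, hz₀, hzne⟩ := (Submodule.ne_bot_iff _).mp hB0
  have h0 : e w₀ ∈ B.gr 0 := by
    have hproj : ∀ c, c ≠ 0 → gradedProj B.gr_internal c (e w₀) = 0 := by
      intro c hc
      rcases lt_or_ge c 0 with hc' | hc'
      · exact B.eq_zero_of_mem_neg (gradedProj_mem _ _ _) hc'
      · obtain ⟨c, rfl⟩ := Int.eq_ofNat_of_zero_le hc'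
        by_contra h
        obtain ⟨v, hv⟩ := B.exists_otL_eq hB (gradedProj_mem B.gr_internal c (e w₀)) h 0
          (by simpa using hz₀)
        rw [← B.gradedProj_otL, ← A.map_otL B e he,
          A.eq_zero_of_mem_neg (A.otL_mem _ v hw₀) (by omega), map_zero, map_zero] at hv
        exact hzne hv.symm
    have h1 : e w₀ = gradedProj B.gr_internal 0 (e w₀) := by
      have h2 := finsum_gradedProj B.gr_internal (fun _ => LinearMap.id) (e w₀)
      have h3 : gradedLift B.gr_internal (fun _ => LinearMap.id) = LinearMap.id :=
        graded_ext B.gr_internal fun a x hx => gradedLift_of_mem _ _ hx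
      rw [h3, finsum_eq_single _ 0 fun n hn => by simpa using hproj n hn] at h2
      exact h2.symm
    rw [h1]
    exact gradedProj_mem _ _ _
  obtain ⟨v, rfl⟩ := A.exists_otL_eq hA (c := 0) (by simpa using hw₀) hne n hw
  rw [A.map_otL B e he]
  have := B.otL_mem ((n : ℤ) - (0 : ℕ)) v h0
  simpa using this

/-- An irreducible submodule, regraded to start at degree `l`. -/
noncomputable def restrict (P : Submodule ℂ M) (hst : A.toWeakMod.IsStable P) (hgr : A.IsGraded P)
    (l : ℕ) (hl : ∀ n : ℤ, n < l → P ⊓ A.gr n = ⊥) : AdmMod d P where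
  act u n := (A.act u n).restrict fun w hw => hst u n w hw
  act_add u v n := by ext w; simp [LinearMap.restrict_apply, A.act_add]
  act_smul c u n := by ext w; simp [LinearMap.restrict_apply, A.act_smul]
  truncation u w := by
    obtain ⟨N, hN⟩ := A.truncation u w
    exact ⟨N, fun n hn => Subtype.ext (hN n hn)⟩
  vacuum_act w n := by
    apply Subtype.ext
    rw [LinearMap.restrict_apply]
    simp only [A.vacuum_act]
    split_ifs <;> rfl
  borcherds p q r u v w := by
    apply P.subtype_injective
    have hinj : Function.Injective P.subtype.toAddMonoidHom := P.subtype_injective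
    have h1 := P.subtype.toAddMonoidHom.map_finsum_of_injective hinj (α := ℕ)
    have h2 := A.borcherds p q r u v w
    refine ((h1 _).trans ?_).trans (h1 _).symm
    simpa [LinearMap.restrict_apply] using h2
  gr n := (A.gr (n + l)).comap P.subtype
  gr_internal := by
    refine (DirectSum.isInternal_submodule_iff_iSupIndep_and_iSup_eq_top _).mpr ⟨?_, ?_⟩
    · refine iSupIndep_of_separating fun n =>
        ⟨gradedProj A.gr_internal (n + l) ∘ₗ P.subtype, ?_, ?_⟩
      · intro x hx h
        rw [LinearMap.comp_apply, gradedProj_of_mem _ hx, if_pos rfl] at h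
        exact Subtype.ext h
      · intro j hj x hx
        rw [LinearMap.comp_apply, gradedProj_of_mem _ hx, if_neg (by omega)]
    · have h : P ≤ (⨆ n : ℤ, (A.gr (n + l)).comap P.subtype).map P.subtype := by
        conv_lhs => rw [hgr]
        refine iSup_le fun n x hx => ⟨⟨x, hx.1⟩, ?_, rfl⟩
        refine Submodule.mem_iSup_of_mem (n - l) ?_
        rw [sub_add_cancel]
        exact hx.2
      refine eq_top_iff.mpr fun x _ => ?_
      obtain ⟨y, hy, hyx⟩ := h x.2
      rwa [← Subtype.ext hyx]
  gr_neg n hn := by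
    refine eq_bot_iff.mpr fun x hx => ?_
    have h : (x : M) ∈ P ⊓ A.gr (n + l) := ⟨x.2, hx⟩
    rw [hl _ (by omega)] at h
    exact Subtype.ext h
  gr_act r u hu m n w hw := by
    have := A.gr_act r u hu m (n + l) w hw
    rw [show r + (n + l) - m - 1 = r + n - m - 1 + l by ring] at this
    exact this

theorem mem_restrict_gr (P : Submodule ℂ M) (hst : A.toWeakMod.IsStable P) (hgr : A.IsGraded P)
    (l : ℕ) (hl : ∀ n : ℤ, n < l → P ⊓ A.gr n = ⊥) (n : ℤ) (x : P) :
    x ∈ (A.restrict P hst hgr l hl).gr n ↔ (x : M) ∈ A.gr (n + l) := Iff.rfl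

theorem gradedProj_mem_of_isGraded {P : Submodule ℂ M} (hgr : A.IsGraded P) (n : ℤ) {x : M}
    (hx : x ∈ P) : gradedProj A.gr_internal n x ∈ P := by
  rw [hgr] at hx
  refine Submodule.iSup_induction _ (motive := fun x => gradedProj A.gr_internal n x ∈ P) hx
    ?_ ?_ ?_
  · intro j x hx
    rw [gradedProj_of_mem _ hx.2]
    split_ifs
    · exact hx.1
    · exact zero_mem _
  · rw [map_zero]; exact zero_mem _
  · intro x y hx hy
    rw [map_add]; exact add_mem hx hy

theorem restrict_isIrreducible {P : Submodule ℂ M} (hP : A.IrredSub P) (l : ℕ)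
    (hl : ∀ n : ℤ, n < l → P ⊓ A.gr n = ⊥) :
    (A.restrict P hP.2.1 hP.2.2.1 l hl).IsIrreducible := by
  obtain ⟨hne, hst, hgr, hmin⟩ := hP
  refine ⟨?_, fun Q hQ hQgr => ?_⟩
  · obtain ⟨x, hx, hx0⟩ := (Submodule.ne_bot_iff _).mp hne
    exact ⟨⟨x, hx⟩, fun h => hx0 (congrArg Subtype.val h)⟩
  · have h := hmin (Q.map P.subtype) (Submodule.map_subtype_le _ _) ?_ ?_
    · rcases h with h | h
      · left
        exact Submodule.map_injective_of_injective P.subtype_injective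
          (h.trans (Submodule.map_bot _).symm)
      · right
        refine Submodule.map_injective_of_injective P.subtype_injective ?_
        rw [h, Submodule.map_subtype_top]
    · rintro u n _ ⟨x, hx, rfl⟩
      exact ⟨_, hQ u n x hx, rfl⟩
    · refine le_antisymm ?_ (iSup_le fun n => inf_le_left)
      rintro _ ⟨x, hx, rfl⟩
      have hx : x ∈ Q := hx
      rw [hQgr] at hx
      refine Submodule.iSup_induction _ (motive := fun x => P.subtype x ∈
        ⨆ n : ℤ, Q.map P.subtype ⊓ A.gr n) hx ?_ ?_ ?_
      · intro j x hx
        exact Submodule.mem_iSup_of_mem (j + l) ⟨⟨x, hx.1, rfl⟩, hx.2⟩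
      · rw [map_zero]; exact zero_mem _
      · intro x y hx hy
        rw [map_add]; exact add_mem hx hy

end AdmMod

section detection
variable {d : VOA V} {k : ℕ} {Mt : Fin k → Type} [∀ i, AddCommGroup (Mt i)] [∀ i, Module ℂ (Mt i)]
  {As : ∀ i, AdmMod d (Mt i)}

theorem AdmMod.IrredSub.exists_detecting {A : AdmMod d M} (hirr : ∀ i, (As i).IsIrreducible)
    (hzero : ∀ i, (As i).gr 0 ≠ ⊥)
    (hcomplete : ∀ (M : Type) [AddCommGroup M] [Module ℂ M] (A : AdmMod d M),
      A.IsIrreducible → A.gr 0 ≠ ⊥ → ∃ i, AdmEquiv A (As i))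
    {P : Submodule ℂ M} (hP : A.IrredSub P) {m : ℕ} {x : M} (hxP : x ∈ P) (hx : x ∈ A.gr m) :
    ∃ (i : Fin k) (l : ℕ) (y : Mt i), l ≤ m ∧ y ∈ (As i).gr ((m : ℤ) - l) ∧
      ∀ t v, (As i).otL t v y = 0 → A.otL t v x = 0 := by
  classical
  have hex : ∃ n : ℕ, P ⊓ A.gr n ≠ ⊥ := by
    by_contra! h
    refine hP.1 ?_
    rw [hP.2.2.1]
    refine iSup_eq_bot.mpr fun n => ?_
    rcases lt_or_ge n 0 with hn | hn
    · rw [A.gr_neg n hn, inf_bot_eq]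
    · obtain ⟨n, rfl⟩ := Int.eq_ofNat_of_zero_le hn
      exact h n
  obtain ⟨l, hl0, hlmin⟩ : ∃ l : ℕ, P ⊓ A.gr l ≠ ⊥ ∧ ∀ j < l, P ⊓ A.gr j = ⊥ :=
    ⟨Nat.find hex, Nat.find_spec hex, fun j hj => not_not.mp (Nat.find_min hex hj)⟩
  have hl : ∀ n : ℤ, n < l → P ⊓ A.gr n = ⊥ := by
    intro n hn
    rcases lt_or_ge n 0 with h | h
    · rw [A.gr_neg n h, inf_bot_eq]
    · obtain ⟨n, rfl⟩ := Int.eq_ofNat_of_zero_le h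
      exact hlmin n (by omega)
  have hR := A.restrict_isIrreducible hP l hl
  set R := A.restrict P hP.2.1 hP.2.2.1 l hl with hRdef
  have hR0 : R.gr 0 ≠ ⊥ := by
    obtain ⟨z, hz, hz0⟩ := (Submodule.ne_bot_iff _).mp hl0
    refine (Submodule.ne_bot_iff _).mpr ⟨⟨z, hz.1⟩, ?_, fun h => hz0 (congrArg Subtype.val h)⟩
    rw [hRdef, A.mem_restrict_gr, zero_add]
    exact hz.2
  obtain ⟨i, e, he⟩ := hcomplete P R hR hR0
  by_cases hx0 : x = 0
  · exact ⟨i, 0, 0, Nat.zero_le _, zero_mem _, fun t v _ => by rw [hx0, map_zero]⟩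
  · have hlm : l ≤ m := by
      by_contra! h
      have : x ∈ P ⊓ A.gr m := ⟨hxP, hx⟩
      rw [hlmin m h] at this
      exact hx0 this
    refine ⟨i, l, e ⟨x, hxP⟩, hlm, ?_, fun t v h => ?_⟩
    · rw [← Nat.cast_sub hlm]
      refine R.equiv_mem_gr (As i) hR (hirr i) hR0 (hzero i) e.toLinearMap he (m - l) ?_
      rw [hRdef, A.mem_restrict_gr, ← Nat.cast_add, Nat.sub_add_cancel hlm]
      exact hx
    · have h1 := R.map_otL (As i) e.toLinearMap he t v ⟨x, hxP⟩
      have h2 := R.map_otL A P.subtype (fun _ _ _ => rfl) t v ⟨x, hxP⟩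
      have h3 : R.otL t v ⟨x, hxP⟩ = 0 := by
        refine e.injective (h1.trans ?_)
        rw [map_zero]
        exact h
      rw [h3, map_zero] at h2
      exact h2.symm

/-- For a rational vertex operator algebra, finitely many vectors in the irreducible modules detect
the subspaces `O_{n,m}(V)`. -/
theorem exists_detecting_family (hrat : Rational d) (hirr : ∀ i, (As i).IsIrreducible)
    (hzero : ∀ i, (As i).gr 0 ≠ ⊥)
    (hcomplete : ∀ (M : Type) [AddCommGroup M] [Module ℂ M] (A : AdmMod d M),
      A.IsIrreducible → A.gr 0 ≠ ⊥ → ∃ i, AdmEquiv A (As i)) (m : ℕ) :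
    ∃ (J : Type) (_ : Finite J) (i : J → Fin k) (l : J → ℕ) (y : ∀ j, Mt (i j)),
      (∀ j, l j ≤ m ∧ y j ∈ (As (i j)).gr ((m : ℤ) - l j)) ∧
      ∀ (n : ℕ) (v : V), (∀ j, (As (i j)).otL (n - m) v (y j) = 0) → v ∈ d.Onm n m := by
  obtain ⟨M, _, _, A, x, hx, hdet⟩ := d.exists_cyclic_adm m
  obtain ⟨ι, f, hf, -, htop⟩ := hrat M A
  obtain ⟨c, hc, hcx⟩ := (Submodule.mem_iSup_iff_exists_finsupp f x).mp (htop ▸ trivial)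
  have hproj : x = ∑ j ∈ c.support, gradedProj A.gr_internal m (c j) := by
    rw [← map_sum]
    have : ∑ j ∈ c.support, c j = x := hcx
    rw [this, gradedProj_of_mem _ hx, if_pos rfl]
  have h := fun j : ι => (hf j).exists_detecting hirr hzero hcomplete
    (A.gradedProj_mem_of_isGraded (hf j).2.2.1 m (hc j)) (gradedProj_mem A.gr_internal m (c j))
  choose i l y h1 h2 h3 using h
  refine ⟨c.support, inferInstance, fun j => i j, fun j => l j, fun j => y j,
    fun j => ⟨h1 j, h2 j⟩, fun n v hv => hdet n v ?_⟩
  rw [hproj, map_sum]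
  exact sum_eq_zero fun j hj => h3 j _ _ (hv ⟨j, hj⟩)

end detection

section Schur
open Polynomial
variable {W : Type} [AddCommGroup W] [Module ℂ W]

theorem aeval_injective_of_sub_injective (f : Module.End ℂ W)
    (h : ∀ c : ℂ, Function.Injective (f - algebraMap ℂ (Module.End ℂ W) c))
    {p : ℂ[X]} (hp : p ≠ 0) :
    Function.Injective (aeval f p) := by
  have key : ∀ s : Multiset ℂ,
      Function.Injective (aeval f (s.map fun a => X - C a).prod : Module.End ℂ W) := by
    intro s
    induction s using Multiset.induction with
    | empty =>
      rw [Multiset.map_zero, Multiset.prod_zero, map_one]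
      exact Function.injective_id
    | cons a s ih =>
      rw [Multiset.map_cons, Multiset.prod_cons, map_mul, Module.End.mul_eq_comp,
        LinearMap.coe_comp]
      refine Function.Injective.comp ?_ ih
      simpa using h a
  have hs := (IsAlgClosed.splits p).eq_prod_roots
  rw [hs, map_mul, Module.End.mul_eq_comp, LinearMap.coe_comp]
  refine Function.Injective.comp ?_ (key _)
  intro x y hxy
  simpa [hp] using hxy

/-- Dixmier's form of Schur's lemma. -/
theorem exists_eq_algebraMap_of_countable [Nontrivial W] {S : Set W} (hS : S.Countable)
    (hspan : Submodule.span ℂ S = ⊤) (f : Module.End ℂ W)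
    (h : ∀ c : ℂ, Function.Bijective (f - algebraMap ℂ (Module.End ℂ W) c) ∨ f = algebraMap ℂ _ c) :
    ∃ c : ℂ, f = algebraMap ℂ _ c := by
  by_contra hne
  push Not at hne
  have hb : ∀ c : ℂ, Function.Bijective (f - algebraMap ℂ (Module.End ℂ W) c) :=
    fun c => (h c).resolve_right (hne c)
  obtain ⟨w, hw⟩ := exists_ne (0 : W)
  choose g hg using fun c => (hb c).2 w
  have hind : LinearIndependent ℂ g := by
    classical
    rw [linearIndependent_iff']
    intro s a hs c hc
    set P : ℂ[X] := ∑ i ∈ s, C (a i) * ∏ j ∈ s.erase i, (X - C j) with hP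
    have hPw : aeval f P w = 0 := by
      have h0 := congrArg (aeval f (∏ j ∈ s, (X - C j))) hs
      rw [map_zero, map_sum] at h0
      rw [hP, map_sum, LinearMap.sum_apply, ← h0]
      refine sum_congr rfl fun i hi => ?_
      rw [← mul_prod_erase s _ hi, mul_comm (X - C i), map_mul, map_mul, map_smul,
        Module.End.mul_apply, Module.End.mul_apply]
      have : aeval f (X - C i) (g i) = w := by simpa using hg i
      rw [this, aeval_C, Module.algebraMap_end_apply]
    have hP0 : P = 0 := by
      by_contra hPne
      exact hw (aeval_injective_of_sub_injective f (fun c => (hb c).1) hPne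
        (by rw [hPw, map_zero]))
    have he := congrArg (eval c) hP0
    rw [hP, eval_finsetSum, sum_eq_single_of_mem c hc, eval_mul, eval_C, eval_prod, eval_zero,
      mul_eq_zero] at he
    · refine he.resolve_right (prod_ne_zero_iff.mpr fun j hj => ?_)
      simpa [sub_eq_zero] using (ne_of_mem_erase hj).symm
    · intro i _ hic
      rw [eval_mul, eval_prod, prod_eq_zero (mem_erase.mpr ⟨hic.symm, hc⟩) (by simp), mul_zero]
  have h1 := hind.cardinal_le_rank
  have h2 : Module.rank ℂ W ≤ Cardinal.aleph0 := by
    rw [← rank_top ℂ W, ← hspan]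
    exact (rank_span_le S).trans hS.le_aleph0
  rw [Cardinal.mk_complex] at h1
  exact absurd (h1.trans h2) (not_le.mpr Cardinal.aleph0_lt_continuum)

end Schur

section density
variable {ι R : Type} [Finite ι] [Ring R] [Algebra ℂ R] {W : ι → Type} [∀ i, AddCommGroup (W i)]
  [∀ i, Module ℂ (W i)] [∀ i, Module R (W i)] [∀ i, IsScalarTower ℂ R (W i)]

theorem exists_eq_smul_of_isSimpleModule {W : Type} [AddCommGroup W] [Module ℂ W] [Module R W]
    [IsScalarTower ℂ R W] [IsSimpleModule R W] {S : Set W} (hS : S.Countable)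
    (hspan : Submodule.span ℂ S = ⊤) (f : W →ₗ[R] W) : ∃ c : ℂ, ∀ x, f x = c • x := by
  have : Nontrivial W := IsSimpleModule.nontrivial R W
  have hcomm : SMulCommClass R ℂ W := IsScalarTower.to_smulCommClass'
  have key := exists_eq_algebraMap_of_countable hS hspan (f.restrictScalars ℂ) fun c => by
    rcases LinearMap.bijective_or_eq_zero (f - c • LinearMap.id) with h | h
    · exact Or.inl h
    · refine Or.inr (LinearMap.ext fun x => ?_)
      simpa [sub_eq_zero] using LinearMap.congr_fun h x
  obtain ⟨c, hc⟩ := key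
  exact ⟨c, fun x => by simpa using LinearMap.congr_fun hc x⟩

/-- The density theorem for finitely many pairwise inequivalent simple modules of countable
dimension over a complex algebra. -/
theorem exists_smul_eq_of_isSimpleModule (hs : ∀ i, IsSimpleModule R (W i))
    (hne : ∀ i j, i ≠ j → ∀ f : W i →ₗ[R] W j, ¬ Function.Bijective f)
    {S : ∀ i, Set (W i)} (hS : ∀ i, (S i).Countable) (hspan : ∀ i, Submodule.span ℂ (S i) = ⊤)
    (φ : ∀ i, Module.End ℂ (W i)) (s : ∀ i, Finset (W i)) :
    ∃ r : R, ∀ i, ∀ x ∈ s i, r • x = φ i x := by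
  classical
  have := Fintype.ofFinite ι
  let F : Module.End (Module.End R (∀ i, W i)) (∀ i, W i) :=
    { toFun := fun x i => φ i (x i)
      map_add' := fun x y => by ext i; simp
      map_smul' := fun g x => by
        ext i
        have hcomp : ∀ j, ∃ c : ℂ,
            ∀ y, g (Pi.single j y) i = c • (Pi.single j y : ∀ i, W i) i := by
          intro j
          by_cases hij : j = i
          · subst hij
            obtain ⟨c, hc⟩ := exists_eq_smul_of_isSimpleModule (R := R) (hS j) (hspan j)
              (LinearMap.proj j ∘ₗ g ∘ₗ LinearMap.single R W j)
            exact ⟨c, fun y => by simpa using hc y⟩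
          · refine ⟨0, fun y => ?_⟩
            have := (LinearMap.bijective_or_eq_zero
              (LinearMap.proj i ∘ₗ g ∘ₗ LinearMap.single R W j)).resolve_left (hne j i hij _)
            simpa using LinearMap.congr_fun this y
        obtain ⟨c, hc⟩ : ∃ c : ℂ, ∀ y, g y i = c • y i := by
          choose c hc using hcomp
          refine ⟨c i, fun y => ?_⟩
          conv_lhs => rw [← Finset.univ_sum_single y]
          rw [map_sum, Finset.sum_apply, sum_eq_single_of_mem i (mem_univ i), hc, Pi.single_eq_same]
          intro j _ hj
          rw [hc, Pi.single_eq_of_ne hj.symm, smul_zero]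
        simp [hc] }
  obtain ⟨r, hr⟩ := jacobson_density F (univ.biUnion fun i => (s i).image (Pi.single i))
  refine ⟨r, fun i x hx => ?_⟩
  have := congrFun (hr (Pi.single i x)
    (mem_biUnion.mpr ⟨i, mem_univ i, mem_image_of_mem _ hx⟩)) i
  simpa [F] using this.symm

end density

theorem VOA.exists_countable_span (d : VOA V) :
    ∃ S : Set V, S.Countable ∧ Submodule.span ℂ S = ⊤ := by
  have h : ∀ n : ℤ, ∃ s : Set V, s.Finite ∧ Submodule.span ℂ s = d.grading n := fun n => by
    have := d.fin_dim n
    obtain ⟨s, hs⟩ := (Submodule.fg_iff_finiteDimensional (d.grading n)).mpr this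
    exact ⟨s, s.finite_toSet, hs⟩
  choose s hs hspan using h
  refine ⟨⋃ n, s n, Set.countable_iUnion fun n => (hs n).countable, eq_top_iff.mpr fun x _ => ?_⟩
  refine graded_induction (p := fun x => x ∈ Submodule.span ℂ (⋃ n, s n)) d.internal ?_ ?_ x
  · intro n x hx
    rw [← hspan n] at hx
    exact Submodule.span_mono (Set.subset_iUnion s n) hx
  · exact fun x y hx hy => add_mem hx hy

namespace AdmMod
variable {d : VOA V} (A : AdmMod d M)

theorem exists_countable_span (hA : A.IsIrreducible) (hA0 : A.gr 0 ≠ ⊥) :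
    ∃ S : Set M, S.Countable ∧ Submodule.span ℂ S = ⊤ := by
  obtain ⟨S, hS, hspan⟩ := d.exists_countable_span
  obtain ⟨w, hw, hw0⟩ := Submodule.exists_mem_ne_zero_of_ne_bot hA0
  refine ⟨⋃ n : ℕ, (fun v => A.otL n v w) '' S, Set.countable_iUnion fun n => hS.image _,
    eq_top_iff.mpr fun x _ => ?_⟩
  refine graded_induction (p := fun x => x ∈ Submodule.span ℂ _) A.gr_internal ?_ ?_ x
  · intro n x hx
    rcases lt_or_ge n 0 with hn | hn
    · rw [A.eq_zero_of_mem_neg hx hn]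
      exact zero_mem _
    · lift n to ℕ using hn
      obtain ⟨v, hv⟩ := A.exists_otL_eq hA (c := 0) hw hw0 n hx
      have hv' : v ∈ Submodule.span ℂ S := hspan ▸ Submodule.mem_top
      have := Submodule.mem_map_of_mem (f := (A.otL n).flip w) hv'
      rw [Submodule.map_span] at this
      rw [← hv]
      refine Submodule.span_mono (Set.subset_iUnion_of_subset n subset_rfl) ?_
      exact this
  · exact fun x y hx hy => add_mem hx hy

variable {M₂ : Type} [AddCommGroup M₂] [Module ℂ M₂] (B : AdmMod d M₂)

/-- A bijection intertwining all operators `otL (q - p) v ∘ gradedProj (p - l)` and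
`otL (q - p) v ∘ gradedProj (p - l')` is an equivalence of modules, and `l = l'`. -/
theorem admEquiv_of_intertwine (hA : A.IsIrreducible) (hB : B.IsIrreducible) (hA0 : A.gr 0 ≠ ⊥)
    (hB0 : B.gr 0 ≠ ⊥) (l l' : ℕ) (f : M →ₗ[ℂ] M₂) (hf : Function.Bijective f)
    (h : ∀ (p q : ℕ) (v : V) (x : M), f (A.otL (q - p) v (gradedProj A.gr_internal (p - l) x)) =
      B.otL (q - p) v (gradedProj B.gr_internal (p - l') (f x))) :
    AdmEquiv A B ∧ l = l' := by
  have hgr : ∀ (c : ℕ) (x : M), x ∈ A.gr c → f x ∈ B.gr (c + l - l') := by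
    intro c x hx
    have := h (c + l) (c + l) d.vacuum x
    rw [sub_self, A.otL_vacuum, B.otL_vacuum, gradedProj_of_mem A.gr_internal hx,
      if_pos (by push_cast; ring)] at this
    rw [this]
    have h2 := gradedProj_mem B.gr_internal (((c + l : ℕ) : ℤ) - l') (f x)
    push_cast at h2
    exact h2
  have hot : ∀ (t : ℤ) (v : V) (x : M), f (A.otL t v x) = B.otL t v (f x) := by
    intro t v x
    refine graded_induction (p := fun x => f (A.otL t v x) = B.otL t v (f x)) A.gr_internal ?_ ?_ x
    · intro c x hx
      rcases lt_or_ge c 0 with hc | hc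
      · rw [A.eq_zero_of_mem_neg hx hc]; simp
      lift c to ℕ using hc
      have hfx := hgr c x hx
      rcases lt_or_ge ((c : ℤ) + l + t) 0 with hct | hct
      · rw [A.eq_zero_of_mem_neg (A.otL_mem t v hx) (by lia),
          B.eq_zero_of_mem_neg (B.otL_mem t v hfx) (by lia), map_zero]
      · obtain ⟨q, hq⟩ := Int.eq_ofNat_of_zero_le hct
        have := h (c + l) q v x
        rw [gradedProj_of_mem A.gr_internal hx, if_pos (by push_cast; ring),
          gradedProj_of_mem B.gr_internal hfx, if_pos (by push_cast; ring),
          show (q : ℤ) - ((c + l : ℕ) : ℤ) = t by push_cast; lia] at this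
        exact this
    · intro x y hx hy
      simp only [map_add, hx, hy]
  have hact : ∀ u n w, f (A.act u n w) = B.act u n (f w) := by
    intro u n w
    refine graded_induction (p := fun u => ∀ n, f (A.act u n w) = B.act u n (f w)) d.internal
      ?_ ?_ u n
    · intro r u hu n
      have := hot (r - 1 - n) u w
      rwa [A.otL_of_mem _ hu, B.otL_of_mem _ hu, sub_sub_cancel] at this
    · intro x y hx hy n
      rw [A.act_add, B.act_add, LinearMap.add_apply, LinearMap.add_apply, map_add, hx, hy]
  refine ⟨⟨LinearEquiv.ofBijective f hf, hact⟩, ?_⟩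
  obtain ⟨w, hw, hw0⟩ := Submodule.exists_mem_ne_zero_of_ne_bot hA0
  have h1 : f w ∈ B.gr (0 : ℕ) :=
    A.equiv_mem_gr B hA hB hA0 hB0 (LinearEquiv.ofBijective f hf) hact 0 hw
  have h2 := hgr 0 w hw
  have h3 := gradedProj_of_mem B.gr_internal h2 (0 : ℕ)
  rw [gradedProj_of_mem B.gr_internal h1, if_pos rfl] at h3
  by_contra hl
  rw [if_neg (by push_cast; lia)] at h3
  exact hw0 (hf.1 (h3.trans (map_zero f).symm))

end AdmMod

section transit
variable {d : VOA V} {k : ℕ} {Mt : Fin k → Type} [∀ i, AddCommGroup (Mt i)] [∀ i, Module ℂ (Mt i)]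
  (As : ∀ i, AdmMod d (Mt i)) (N : ℕ)

/-- The simultaneous action of `v` from the pieces of degree `p - l` to those of degree `q - l`. -/
noncomputable def transit (p q : ℕ) :
    V →ₗ[ℂ] (∀ j : Fin N × Fin k, Module.End ℂ (Mt j.2)) where
  toFun v j := (As j.2).otL (q - p) v ∘ₗ gradedProj (As j.2).gr_internal (p - (j.1 : ℕ))
  map_add' u v := by ext; simp
  map_smul' c v := by ext; simp

theorem transit_apply (p q : ℕ) (v : V) (j : Fin N × Fin k) (x : Mt j.2) :
    transit As N p q v j x =
      (As j.2).otL (q - p) v (gradedProj (As j.2).gr_internal (p - (j.1 : ℕ)) x) := rfl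

theorem transit_mul (p q p' q' : ℕ) (u v : V) :
    transit As N p' q' u * transit As N p q v =
      if p' = q then transit As N p q' (d.starL p q q' u v) else 0 := by
  ext j x
  rw [Pi.mul_apply, Module.End.mul_apply, transit_apply, transit_apply]
  have hx := gradedProj_mem (As j.2).gr_internal (p - (j.1 : ℕ)) x
  rw [gradedProj_of_mem _ ((As j.2).otL_mem (q - p) v hx)]
  by_cases h : p' = q
  · subst h
    rw [if_pos rfl, if_pos (by ring), transit_apply, (As j.2).otL_starL p p' q' u v hx (by lia)]
  · rw [if_neg h, if_neg (by lia)]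
    simp

/-- The span of all transition operators out of level `p`. -/
noncomputable def transitSpan (p : ℕ) : Submodule ℂ (∀ j : Fin N × Fin k, Module.End ℂ (Mt j.2)) :=
  ⨆ q, LinearMap.range (transit As N p q)

theorem transit_mem_transitSpan (p q : ℕ) (v : V) : transit As N p q v ∈ transitSpan As N p :=
  Submodule.mem_iSup_of_mem q ⟨v, rfl⟩

theorem transitSpan_induction {p : ℕ} {P : (∀ j : Fin N × Fin k, Module.End ℂ (Mt j.2)) → Prop}
    (hP : ∀ q v, P (transit As N p q v)) (hadd : ∀ x y, P x → P y → P (x + y))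
    {x : ∀ j : Fin N × Fin k, Module.End ℂ (Mt j.2)} (hx : x ∈ transitSpan As N p) : P x := by
  refine Submodule.iSup_induction _ (motive := P) hx ?_ ?_ hadd
  · rintro q _ ⟨v, rfl⟩
    exact hP q v
  · simpa using hP 0 0

/-- The algebra of operators preserving the spans of transition operators. -/
def transitAlgebra : Subalgebra ℂ (∀ j : Fin N × Fin k, Module.End ℂ (Mt j.2)) where
  carrier := {r | ∀ p, ∀ x ∈ transitSpan As N p, r * x ∈ transitSpan As N p}
  mul_mem' ha hb p x hx := by rw [mul_assoc]; exact ha p _ (hb p x hx)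
  add_mem' ha hb p x hx := by rw [add_mul]; exact add_mem (ha p x hx) (hb p x hx)
  algebraMap_mem' c p x hx := by
    rw [← Algebra.smul_def]; exact Submodule.smul_mem _ c hx

theorem transit_mem_transitAlgebra (p q : ℕ) (v : V) :
    transit As N p q v ∈ transitAlgebra As N := fun p' x hx => by
  refine transitSpan_induction As N
    (P := fun x => transit As N p q v * x ∈ transitSpan As N p') ?_ ?_ hx
  · intro q' u
    rw [transit_mul]
    split_ifs
    · exact transit_mem_transitSpan As N _ _ _
    · exact zero_mem _
  · intro x y hx hy
    rw [mul_add]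
    exact add_mem hx hy

theorem exists_transit_eq {r : ∀ j : Fin N × Fin k, Module.End ℂ (Mt j.2)}
    (hr : r ∈ transitAlgebra As N) (p q : ℕ) :
    ∃ v, transit As N q q d.vacuum * (r * transit As N p p d.vacuum) = transit As N p q v := by
  refine transitSpan_induction As N
    (P := fun x => ∃ v, transit As N q q d.vacuum * x = transit As N p q v) ?_ ?_
    (hr p _ (transit_mem_transitSpan As N p p d.vacuum))
  · intro q' u
    rw [transit_mul]
    split_ifs with h
    · exact ⟨_, rfl⟩
    · exact ⟨0, (map_zero _).symm⟩
  · rintro x y ⟨v, hv⟩ ⟨v', hv'⟩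
    exact ⟨v + v', by rw [mul_add, hv, hv', map_add]⟩

instance (j : Fin N × Fin k) : Module (transitAlgebra As N) (Mt j.2) :=
  Module.compHom (Mt j.2) ((Pi.evalRingHom (fun j : Fin N × Fin k => Module.End ℂ (Mt j.2)) j).comp
    (transitAlgebra As N).val.toRingHom)

theorem transitAlgebra_smul (r : transitAlgebra As N) (j : Fin N × Fin k) (x : Mt j.2) :
    r • x = r.1 j x := rfl

instance (j : Fin N × Fin k) : IsScalarTower ℂ (transitAlgebra As N) (Mt j.2) :=
  ⟨fun c r x => by simp [transitAlgebra_smul]⟩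

variable {As}

theorem isSimpleModule_transitAlgebra (hirr : ∀ i, (As i).IsIrreducible) (j : Fin N × Fin k) :
    IsSimpleModule (transitAlgebra As N) (Mt j.2) := by
  rw [isSimpleModule_iff_toSpanSingleton_surjective]
  refine ⟨let ⟨w, hw⟩ := (hirr j.2).1; ⟨w, 0, hw⟩, fun w hw w' => ?_⟩
  obtain ⟨c, hc⟩ : ∃ c : ℤ, gradedProj (As j.2).gr_internal c w ≠ 0 := by
    by_contra! h
    refine hw ?_
    have := finsum_gradedProj (As j.2).gr_internal (fun _ => LinearMap.id) w
    have h2 : gradedLift (As j.2).gr_internal (fun _ => (LinearMap.id : Mt j.2 →ₗ[ℂ] Mt j.2))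
        = LinearMap.id := graded_ext (As j.2).gr_internal fun a x hx => gradedLift_of_mem _ _ hx
    rw [h2] at this
    simpa [h] using this.symm
  have hcm := gradedProj_mem (As j.2).gr_internal c w
  have hc0 : 0 ≤ c := not_lt.mp fun h => hc ((As j.2).eq_zero_of_mem_neg hcm h)
  lift c to ℕ using hc0
  refine graded_induction (p := fun w' => ∃ r : transitAlgebra As N, r • w = w')
    (As j.2).gr_internal ?_ ?_ w'
  · intro b x hx
    rcases lt_or_ge b 0 with hb | hb
    · exact ⟨0, by rw [zero_smul, (As j.2).eq_zero_of_mem_neg hx hb]⟩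
    lift b to ℕ using hb
    obtain ⟨v, hv⟩ := (As j.2).exists_otL_eq (hirr j.2) hcm hc b hx
    refine ⟨⟨_, transit_mem_transitAlgebra As N (c + j.1) (b + j.1) v⟩, ?_⟩
    rw [transitAlgebra_smul, transit_apply, ← hv]
    push_cast
    rw [add_sub_cancel_right, add_sub_add_right_eq_sub]
  · rintro x y ⟨r, rfl⟩ ⟨r', rfl⟩
    exact ⟨r + r', add_smul r r' w⟩

theorem exists_otL_eq_of_finset (hirr : ∀ i, (As i).IsIrreducible) (hzero : ∀ i, (As i).gr 0 ≠ ⊥)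
    (hdistinct : ∀ i j, i ≠ j → ¬ AdmEquiv (As i) (As j)) (m n : ℕ)
    (φ : ∀ j : Fin N × Fin k, Module.End ℂ (Mt j.2)) (s : ∀ j : Fin N × Fin k, Finset (Mt j.2))
    (hs : ∀ j, ∀ x ∈ s j, x ∈ (As j.2).gr (m - (j.1 : ℕ)) ∧ φ j x ∈ (As j.2).gr (n - (j.1 : ℕ))) :
    ∃ v : V, ∀ j, ∀ x ∈ s j, (As j.2).otL (n - m) v x = φ j x := by
  have hcount := fun j : Fin N × Fin k => (As j.2).exists_countable_span (hirr j.2) (hzero j.2)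
  choose S hS hspan using hcount
  obtain ⟨r, hr⟩ := exists_smul_eq_of_isSimpleModule (R := transitAlgebra As N)
    (isSimpleModule_transitAlgebra N hirr) (fun j j' hj f hf => by
      obtain ⟨h1, h2⟩ := (As j.2).admEquiv_of_intertwine (As j'.2) (hirr _) (hirr _) (hzero _)
        (hzero _) j.1 j'.1 (f.restrictScalars ℂ) hf fun p q v x =>
          f.map_smul ⟨_, transit_mem_transitAlgebra As N p q v⟩ x
      refine hj (Prod.ext (Fin.ext h2) ?_)
      by_contra h
      exact hdistinct _ _ h h1) hS hspan φ s
  obtain ⟨v, hv⟩ := exists_transit_eq As N r.2 m n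
  refine ⟨v, fun j x hx => ?_⟩
  have h1 := LinearMap.congr_fun (congrFun hv j) x
  rw [Pi.mul_apply, Pi.mul_apply, Module.End.mul_apply, Module.End.mul_apply, transit_apply,
    transit_apply, transit_apply, gradedProj_of_mem _ (hs j x hx).1, if_pos rfl, sub_self,
    sub_self, AdmMod.otL_vacuum, AdmMod.otL_vacuum] at h1
  have h2 : r.1 j x = φ j x := hr j x hx
  rw [h2, gradedProj_of_mem _ (hs j x hx).2, if_pos rfl] at h1
  exact h1.symm

end transit

section main
variable {d : VOA V} {k : ℕ} {Mt : Fin k → Type} [∀ i, AddCommGroup (Mt i)] [∀ i, Module ℂ (Mt i)]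
  {As : ∀ i, AdmMod d (Mt i)}

theorem exists_detecting_finset (hrat : Rational d) (hirr : ∀ i, (As i).IsIrreducible)
    (hzero : ∀ i, (As i).gr 0 ≠ ⊥)
    (hcomplete : ∀ (M : Type) [AddCommGroup M] [Module ℂ M] (A : AdmMod d M),
      A.IsIrreducible → A.gr 0 ≠ ⊥ → ∃ i, AdmEquiv A (As i)) (m : ℕ) :
    ∃ Y : ∀ j : Fin (m + 1) × Fin k, Finset (Mt j.2),
      (∀ j, ∀ y ∈ Y j, y ∈ (As j.2).gr (m - (j.1 : ℕ))) ∧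
      ∀ (n : ℕ) (v : V), (∀ j, ∀ y ∈ Y j, (As j.2).otL (n - m) v y = 0) → v ∈ d.Onm n m := by
  obtain ⟨J, _, i, l, y, hy, hdet⟩ := exists_detecting_family hrat hirr hzero hcomplete m
  let T : J → (Σ j : Fin (m + 1) × Fin k, Mt j.2) :=
    fun a => ⟨(⟨l a, Nat.lt_succ_of_le (hy a).1⟩, i a), y a⟩
  have hfin : ∀ j, (Sigma.mk j ⁻¹' Set.range T).Finite := fun j =>
    (Set.finite_range T).preimage sigma_mk_injective.injOn
  refine ⟨fun j => (hfin j).toFinset, ?_, fun n v hv => hdet n v fun a => ?_⟩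
  · intro j z hz
    obtain ⟨a, ha⟩ := (hfin j).mem_toFinset.mp hz
    cases ha
    exact (hy a).2
  · exact hv (⟨l a, Nat.lt_succ_of_le (hy a).1⟩, i a) (y a)
      ((hfin _).mem_toFinset.mpr ⟨a, rfl⟩)

theorem exists_detecting_span (hrat : Rational d) (hirr : ∀ i, (As i).IsIrreducible)
    (hzero : ∀ i, (As i).gr 0 ≠ ⊥) (hdistinct : ∀ i j, i ≠ j → ¬ AdmEquiv (As i) (As j))
    (hcomplete : ∀ (M : Type) [AddCommGroup M] [Module ℂ M] (A : AdmMod d M),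
      A.IsIrreducible → A.gr 0 ≠ ⊥ → ∃ i, AdmEquiv A (As i)) (m : ℕ) :
    ∃ Y : ∀ j : Fin (m + 1) × Fin k, Finset (Mt j.2),
      (∀ j, Submodule.span ℂ (Y j : Set (Mt j.2)) = (As j.2).gr (m - (j.1 : ℕ))) ∧
      ∀ (n : ℕ) (v : V), (∀ j, ∀ y ∈ Y j, (As j.2).otL (n - m) v y = 0) → v ∈ d.Onm n m := by
  classical
  obtain ⟨Y, hY, hdet⟩ := exists_detecting_finset hrat hirr hzero hcomplete m
  refine ⟨Y, fun j => le_antisymm (Submodule.span_le.mpr (hY j)) fun x hx => ?_, hdet⟩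
  by_contra hxY
  obtain ⟨f, hfx, hf⟩ := Submodule.exists_le_ker_of_notMem hxY
  let φ : Module.End ℂ (Mt j.2) := f.smulRight x
  have hφY : ∀ y ∈ Y j, φ y = 0 := fun y hy => by
    have : f y = 0 := hf (Submodule.subset_span hy)
    simp [φ, this]
  obtain ⟨v, hv⟩ := exists_otL_eq_of_finset (m + 1) hirr hzero hdistinct m m
    (Function.update 0 j φ) (Function.update Y j (insert x (Y j))) (by
      intro j' z hz
      by_cases hj : j' = j
      · subst hj
        rw [Function.update_self, mem_insert] at hz
        rw [Function.update_self]
        rcases hz with rfl | hz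
        · exact ⟨hx, Submodule.smul_mem _ _ hx⟩
        · rw [hφY z hz]
          exact ⟨hY _ z hz, zero_mem _⟩
      · rw [Function.update_of_ne hj] at hz
        rw [Function.update_of_ne hj]
        exact ⟨hY _ z hz, zero_mem _⟩)
  have hvO : v ∈ d.Onm m m := hdet m v fun j' z hz => by
    by_cases hj : j' = j
    · subst hj
      rw [hv j' z (by rw [Function.update_self]; exact mem_insert_of_mem hz), Function.update_self,
        hφY z hz]
    · rw [hv j' z (by rwa [Function.update_of_ne hj]), Function.update_of_ne hj]
      rfl
  have h1 := hv j x (by rw [Function.update_self]; exact mem_insert_self _ _)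
  rw [(As j.2).otL_Onm m m hvO hx (by lia), Function.update_self] at h1
  have hx0 : x = 0 := by
    have : f x • x = 0 := h1.symm
    exact (smul_eq_zero.mp this).resolve_left hfx
  exact hxY (hx0 ▸ zero_mem _)

variable (As)

theorem otL_mem_gr_sub (n m l : ℕ) (i : Fin k) (v : V) (w : Mt i)
    (hw : w ∈ (As i).gr ((m : ℤ) - l)) :
    (As i).otL (n - m) v w ∈ (As i).gr ((n : ℤ) - l) := by
  have := (As i).otL_mem (n - m) v hw
  rwa [show (m : ℤ) - l + (n - m) = n - l by ring] at this

/-- The action of `V` as maps between the graded pieces of the modules `As i`. -/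
noncomputable def pieceMap (n m : ℕ) :
    V →ₗ[ℂ] (∀ (l : Fin (Nat.min m n + 1)) (i : Fin k),
      ((As i).gr ((m : ℤ) - (l.val : ℤ))) →ₗ[ℂ] ((As i).gr ((n : ℤ) - (l.val : ℤ)))) where
  toFun v l i := ((As i).otL (n - m) v).restrict (otL_mem_gr_sub As n m l i v)
  map_add' u v := by ext; simp
  map_smul' c v := by ext; simp

theorem pieceMap_apply (n m : ℕ) (v : V) (l : Fin (Nat.min m n + 1)) (i : Fin k)
    (w : (As i).gr ((m : ℤ) - (l.val : ℤ))) :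
    (pieceMap As n m v l i w : Mt i) = (As i).otL (n - m) v w := rfl

variable {As}

theorem ker_pieceMap (hrat : Rational d) (hirr : ∀ i, (As i).IsIrreducible)
    (hzero : ∀ i, (As i).gr 0 ≠ ⊥)
    (hcomplete : ∀ (M : Type) [AddCommGroup M] [Module ℂ M] (A : AdmMod d M),
      A.IsIrreducible → A.gr 0 ≠ ⊥ → ∃ i, AdmEquiv A (As i)) (n m : ℕ) :
    LinearMap.ker (pieceMap As n m) = d.Onm n m := by
  ext v
  constructor
  · intro hv
    obtain ⟨Y, hY, hdet⟩ := exists_detecting_finset hrat hirr hzero hcomplete m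
    refine hdet n v fun j y hy => ?_
    by_cases hj : j.1.1 ≤ n
    · have hjm := j.1.2
      have := congrFun (congrFun (LinearMap.mem_ker.mp hv)
        ⟨j.1, Nat.lt_succ_of_le (le_min (by lia) hj)⟩) j.2
      exact congrArg Subtype.val (LinearMap.congr_fun this ⟨y, hY j y hy⟩)
    · exact (As j.2).eq_zero_of_mem_neg (otL_mem_gr_sub As n m j.1 j.2 v y (hY j y hy)) (by lia)
  · intro hv
    rw [LinearMap.mem_ker]
    ext l i w
    rw [pieceMap_apply, (As i).otL_Onm n m hv w.2 (by lia)]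
    rfl

theorem pieceMap_surjective (hrat : Rational d) (hirr : ∀ i, (As i).IsIrreducible)
    (hzero : ∀ i, (As i).gr 0 ≠ ⊥) (hdistinct : ∀ i j, i ≠ j → ¬ AdmEquiv (As i) (As j))
    (hcomplete : ∀ (M : Type) [AddCommGroup M] [Module ℂ M] (A : AdmMod d M),
      A.IsIrreducible → A.gr 0 ≠ ⊥ → ∃ i, AdmEquiv A (As i)) (n m : ℕ) :
    Function.Surjective (pieceMap As n m) := by
  intro ψ
  obtain ⟨Y, hY, -⟩ := exists_detecting_span hrat hirr hzero hdistinct hcomplete m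
  let φ : ∀ j : Fin (m + 1) × Fin k, Module.End ℂ (Mt j.2) := fun j =>
    if h : j.1.1 < Nat.min m n + 1 then
      ((As j.2).gr ((n : ℤ) - (j.1 : ℕ))).subtype ∘ₗ ψ ⟨j.1, h⟩ j.2 ∘ₗ
        (gradedProj (As j.2).gr_internal (m - (j.1 : ℕ))).codRestrict _ (gradedProj_mem _ _)
    else 0
  have hYgr : ∀ j, ∀ y ∈ Y j, y ∈ (As j.2).gr (m - (j.1 : ℕ)) := fun j y hy =>
    hY j ▸ Submodule.subset_span hy
  obtain ⟨v, hv⟩ := exists_otL_eq_of_finset (m + 1) hirr hzero hdistinct m n φ Y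
    fun j y hy => ⟨hYgr j y hy, by
      simp only [φ]
      split_ifs
      · exact Subtype.prop _
      · exact zero_mem _⟩
  refine ⟨v, ?_⟩
  ext l i w
  have hl : l.1 < m + 1 := lt_of_lt_of_le l.2 (Nat.succ_le_succ (Nat.min_le_left m n))
  have hw : (w : Mt i) ∈ Submodule.span ℂ (Y (⟨l, hl⟩, i) : Set (Mt i)) := by
    rw [hY (⟨l, hl⟩, i)]
    exact w.2
  have heq := LinearMap.eqOn_span (f := (As i).otL (n - m) v) (g := φ (⟨l, hl⟩, i))
    (fun y hy => hv (⟨l, hl⟩, i) y hy) hw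
  rw [pieceMap_apply, heq]
  simp only [φ]
  rw [dif_pos l.2]
  change ((ψ l i ⟨gradedProj (As i).gr_internal (m - (l : ℕ)) w, _⟩ : _) : Mt i) = _
  congr 2
  exact Subtype.ext ((gradedProj_of_mem _ w.2 _).trans (if_pos rfl))

end main

end

/-- if `V` is rational with complete list of inequivalent irreducible
modules `W¹, …, W^k` (each with `Wⁱ(0) ≠ 0`), then as an `A_n(V)`-`A_m(V)`-bimodule
`A_{n,m}(V) ≅ ⊕_{l=0}^{min(m,n)} ⊕_i Hom(Wⁱ(m-l), Wⁱ(n-l))`. -/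
theorem stmt18 (d : VOA V) (hrat : Rational d)
    (k : ℕ) (Mt : Fin k → Type) [∀ i, AddCommGroup (Mt i)] [∀ i, Module ℂ (Mt i)]
    (As : ∀ i, AdmMod d (Mt i))
    (hirr : ∀ i, (As i).IsIrreducible)
    (hzero : ∀ i, (As i).gr 0 ≠ ⊥)
    (hdistinct : ∀ i j, i ≠ j → ¬ AdmEquiv (As i) (As j))
    (hcomplete : ∀ (M : Type) [AddCommGroup M] [Module ℂ M] (A : AdmMod d M),
      A.IsIrreducible → A.gr 0 ≠ ⊥ → ∃ i, AdmEquiv A (As i))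
    (n m : ℕ) :
    ∃ e : (V ⧸ d.Onm n m) ≃ₗ[ℂ]
        (∀ (l : Fin (Nat.min m n + 1)) (i : Fin k),
          ((As i).gr ((m : ℤ) - (l.val : ℤ))) →ₗ[ℂ] ((As i).gr ((n : ℤ) - (l.val : ℤ)))),
      (∀ (a v : V) (l : Fin (Nat.min m n + 1)) (i : Fin k)
          (w : ((As i).gr ((m : ℤ) - (l.val : ℤ)))),
        ((e ((d.Onm n m).mkQ (d.starmpn m n n a v)) l i w : Mt i))
          = (As i).toWeakMod.o a ((e ((d.Onm n m).mkQ v) l i w : Mt i))) ∧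
      (∀ (v a : V) (l : Fin (Nat.min m n + 1)) (i : Fin k)
          (w w' : ((As i).gr ((m : ℤ) - (l.val : ℤ)))),
        ((w' : Mt i) = (As i).toWeakMod.o a (w : Mt i)) →
        ((e ((d.Onm n m).mkQ (d.starmpn m m n v a)) l i w : Mt i))
          = (e ((d.Onm n m).mkQ v) l i w' : Mt i)) := by
  let e := (Submodule.quotEquivOfEq _ _
      (ker_pieceMap (As := As) hrat hirr hzero hcomplete n m).symm).trans
    ((pieceMap As n m).quotKerEquivOfSurjective
      (pieceMap_surjective hrat hirr hzero hdistinct hcomplete n m))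
  have he : ∀ v, e ((d.Onm n m).mkQ v) = pieceMap As n m v := fun v => rfl
  refine ⟨e, fun a v l i w => ?_, fun v a l i w w' hw' => ?_⟩
  · rw [he, he, pieceMap_apply, pieceMap_apply, VOA.starmpn_eq,
      (As i).otL_starL m n n a v w.2 (by lia), WeakMod.o_eq, sub_self]
  · rw [he, he, pieceMap_apply, pieceMap_apply, VOA.starmpn_eq,
      (As i).otL_starL m m n v a w.2 (by lia), hw', WeakMod.o_eq, sub_self]
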